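/- The space J_{4,2}(O_K) is two-dimensional, spanned by the linearly independent forms Φ_{4,2} = (x⁶+y⁶)(θ^H_{0,0} + θ^H_{2,2}) + z⁶(θ^H_{1,1} + θ^H_{3,3} + θ^H_{1,3} + θ^H_{3,1}) + (x⁶−y⁶)(θ^H_{0,2} + θ^H_{2,0}) and Φ̃_{4,2} = 2x³y³(θ^H_{0,0} − θ^H_{2,2}) + z³(x³−y³)(θ^H_{0,1} + θ^H_{1,0} + θ^H_{0,3} + θ^H_{3,0}) + z³(x³+y³)(θ^H_{1,2} + θ^H_{2,1} + θ^H_{2,3} + θ^H_{3,2}). -/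

import Mathlib

noncomputable section

open Complex

/-- `τ` lies in the upper half plane. -/
def UHP (τ : ℂ) : Prop := 0 < τ.im

/-- `eC w = exp(2 π i w)`. -/
def eC (w : ℂ) : ℂ := Complex.exp (2 * (Real.pi : ℂ) * Complex.I * w)

/-- Entries of a matrix in `SL(2, ℤ)`, as complex numbers. -/
def Ma (M : Matrix.SpecialLinearGroup (Fin 2) ℤ) : ℂ := ((M.1 0 0 : ℤ) : ℂ)
def Mb (M : Matrix.SpecialLinearGroup (Fin 2) ℤ) : ℂ := ((M.1 0 1 : ℤ) : ℂ)
def Mc (M : Matrix.SpecialLinearGroup (Fin 2) ℤ) : ℂ := ((M.1 1 0 : ℤ) : ℂ)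
def Md (M : Matrix.SpecialLinearGroup (Fin 2) ℤ) : ℂ := ((M.1 1 1 : ℤ) : ℂ)

/-- Hermitian Jacobi form of weight `k` and index `m` for the Hermitian Jacobi group over
`ℤ[i]`.  A form is a function `φ : ℂ → ℂ → ℂ → ℂ`, all conditions being imposed for `τ`
in the upper half plane.  Units `ε ∈ ℤ[i]ˣ = {1, -1, i, -i}`, and the elliptic variables
`λ = p + q i`, `μ = u + v i` range over `ℤ[i]`.  The Fourier expansion is indexed by
`n ∈ ℕ` and `r = (a + b i)/2 ∈ O_K^♯ = (i/2)ℤ[i]`, supported on `N(r) ≤ n m`,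
i.e. `a² + b² ≤ 4 n m`. -/
structure IsHJF (k m : ℕ) (φ : ℂ → ℂ → ℂ → ℂ) : Prop where
  holo : DifferentiableOn ℂ (fun p : ℂ × ℂ × ℂ => φ p.1 p.2.1 p.2.2) {p | UHP p.1}
  transf : ∀ ε : ℂ, ε ∈ ({1, -1, Complex.I, -Complex.I} : Set ℂ) →
    ∀ M : Matrix.SpecialLinearGroup (Fin 2) ℤ, ∀ τ z₁ z₂ : ℂ, UHP τ →
      φ ((Ma M * τ + Mb M) / (Mc M * τ + Md M))
        (ε * z₁ / (Mc M * τ + Md M))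
        ((starRingEnd ℂ) ε * z₂ / (Mc M * τ + Md M))
      = ε ^ k * (Mc M * τ + Md M) ^ k *
          eC ((m : ℂ) * Mc M * z₁ * z₂ / (Mc M * τ + Md M)) * φ τ z₁ z₂
  ellip : ∀ p q u v : ℤ, ∀ τ z₁ z₂ : ℂ, UHP τ →
      φ τ (z₁ + ((p : ℂ) + (q : ℂ) * Complex.I) * τ + ((u : ℂ) + (v : ℂ) * Complex.I))
          (z₂ + ((p : ℂ) - (q : ℂ) * Complex.I) * τ + ((u : ℂ) - (v : ℂ) * Complex.I))
      = eC (-(m : ℂ) * (((p : ℂ) ^ 2 + (q : ℂ) ^ 2) * τ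
          + ((p : ℂ) - (q : ℂ) * Complex.I) * z₁
          + ((p : ℂ) + (q : ℂ) * Complex.I) * z₂)) * φ τ z₁ z₂
  fourier : ∃ c : ℕ → ℤ → ℤ → ℂ,
      (∀ (n : ℕ) (a b : ℤ), 4 * (n : ℤ) * m < a ^ 2 + b ^ 2 → c n a b = 0) ∧
      ∀ τ z₁ z₂ : ℂ, UHP τ →
        HasSum (fun p : ℕ × ℤ × ℤ => c p.1 p.2.1 p.2.2 *
          eC ((p.1 : ℂ) * τ + (((p.2.1 : ℂ) + (p.2.2 : ℂ) * Complex.I) / 2) * z₁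
            + (((p.2.1 : ℂ) - (p.2.2 : ℂ) * Complex.I) / 2) * z₂)) (φ τ z₁ z₂)

/-- Classical Jacobi form of weight `k` and index `m` for `SL(2,ℤ) ⋉ ℤ²`. -/
structure IsJF (k m : ℕ) (φ : ℂ → ℂ → ℂ) : Prop where
  holo : DifferentiableOn ℂ (fun p : ℂ × ℂ => φ p.1 p.2) {p | UHP p.1}
  transf : ∀ M : Matrix.SpecialLinearGroup (Fin 2) ℤ, ∀ τ z : ℂ, UHP τ →
      φ ((Ma M * τ + Mb M) / (Mc M * τ + Md M)) (z / (Mc M * τ + Md M))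
      = (Mc M * τ + Md M) ^ k *
          eC ((m : ℂ) * Mc M * z ^ 2 / (Mc M * τ + Md M)) * φ τ z
  ellip : ∀ p q : ℤ, ∀ τ z : ℂ, UHP τ →
      φ τ (z + (p : ℂ) * τ + (q : ℂ))
      = eC (-(m : ℂ) * ((p : ℂ) ^ 2 * τ + 2 * (p : ℂ) * z)) * φ τ z
  fourier : ∃ c : ℕ → ℤ → ℂ,
      (∀ (n : ℕ) (r : ℤ), 4 * (n : ℤ) * m < r ^ 2 → c n r = 0) ∧
      ∀ τ z : ℂ, UHP τ →
        HasSum (fun p : ℕ × ℤ => c p.1 p.2 * eC ((p.1 : ℂ) * τ + (p.2 : ℂ) * z)) (φ τ z)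

/-- Modular form of weight `k` for `SL(2,ℤ)`. -/
structure IsMF (k : ℕ) (f : ℂ → ℂ) : Prop where
  holo : DifferentiableOn ℂ f {τ | UHP τ}
  transf : ∀ M : Matrix.SpecialLinearGroup (Fin 2) ℤ, ∀ τ : ℂ, UHP τ →
      f ((Ma M * τ + Mb M) / (Mc M * τ + Md M)) = (Mc M * τ + Md M) ^ k * f τ
  bounded : ∃ A B : ℝ, ∀ τ : ℂ, B ≤ τ.im → ‖f τ‖ ≤ A

/-- Cusp form of weight `k` for `SL(2,ℤ)`. -/
structure IsCF (k : ℕ) (f : ℂ → ℂ) : Prop where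
  holo : DifferentiableOn ℂ f {τ | UHP τ}
  transf : ∀ M : Matrix.SpecialLinearGroup (Fin 2) ℤ, ∀ τ : ℂ, UHP τ →
      f ((Ma M * τ + Mb M) / (Mc M * τ + Md M)) = (Mc M * τ + Md M) ^ k * f τ
  decay : ∀ ε : ℝ, 0 < ε → ∃ B : ℝ, ∀ τ : ℂ, B ≤ τ.im → ‖f τ‖ ≤ ε

/-- `M_w(SL(2,ℤ), ω̄)` for the character `ω` of `SL(2,ℤ)` with `ω(T) = ω(S) = i`:
holomorphic functions on the upper half plane, bounded at infinity, with
`f|_w T = -i f` and `f|_w S = -i f`. -/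
structure IsMFOmegaBar (w : ℕ) (f : ℂ → ℂ) : Prop where
  holo : DifferentiableOn ℂ f {τ | UHP τ}
  transT : ∀ τ : ℂ, UHP τ → f (τ + 1) = -Complex.I * f τ
  transS : ∀ τ : ℂ, UHP τ → f (-1 / τ) = -Complex.I * τ ^ w * f τ
  bounded : ∃ A B : ℝ, ∀ τ : ℂ, B ≤ τ.im → ‖f τ‖ ≤ A

/-- Hermitian theta function `θ^H_{m,s}` of index `m` with characteristic
`s = (a + b i)/2 ∈ O_K^♯`; the sum is over `r = s + m (g₁ + g₂ i) ∈ s + m ℤ[i]`. -/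
def thetaH (m : ℕ) (a b : ℤ) (τ z₁ z₂ : ℂ) : ℂ :=
  ∑' g : ℤ × ℤ,
    eC ((((a : ℂ) + 2 * m * g.1) ^ 2 + ((b : ℂ) + 2 * m * g.2) ^ 2) / (4 * m) * τ
      + (((a : ℂ) + 2 * m * g.1) + ((b : ℂ) + 2 * m * g.2) * Complex.I) / 2 * z₁
      + (((a : ℂ) + 2 * m * g.1) - ((b : ℂ) + 2 * m * g.2) * Complex.I) / 2 * z₂)

/-- Classical theta function `θ_{m,μ}(τ,z) = Σ_{r ≡ μ mod 2m} e(r²τ/(4m) + r z)`. -/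
def thetaJ (m : ℕ) (μ : ℤ) (τ z : ℂ) : ℂ :=
  ∑' g : ℤ, eC (((μ : ℂ) + 2 * m * g) ^ 2 / (4 * m) * τ + ((μ : ℂ) + 2 * m * g) * z)

/-- `h` is the family of theta components of `φ` (for index `m`): the `h_{a,b}` depend
only on `(a, b) mod 2m` and `φ = Σ_{s ∈ O_K^♯ / m O_K} h_s θ^H_{m,s}`. -/
def HasThetaDecomp (m : ℕ) (φ : ℂ → ℂ → ℂ → ℂ) (h : ℤ → ℤ → ℂ → ℂ) : Prop :=
  (∀ (a b : ℤ) (τ : ℂ), h (a + 2 * m) b τ = h a b τ ∧ h a (b + 2 * m) τ = h a b τ) ∧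
  ∀ τ z₁ z₂ : ℂ, UHP τ →
    φ τ z₁ z₂ = ∑ a ∈ Finset.range (2 * m), ∑ b ∈ Finset.range (2 * m),
      h (a : ℤ) (b : ℤ) τ * thetaH m (a : ℤ) (b : ℤ) τ z₁ z₂

/-- `ϑ₀(τ) = Σ_{r ∈ ℤ} e(r² τ)`. -/
def theta0C (τ : ℂ) : ℂ := ∑' r : ℤ, eC ((r : ℂ) ^ 2 * τ)

/-- `ϑ₁(τ) = Σ_{r odd} e(r² τ / 4)`. -/
def theta1C (τ : ℂ) : ℂ := ∑' r : ℤ, eC ((2 * (r : ℂ) + 1) ^ 2 * τ / 4)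

/-- `ξ = ϑ₁ ϑ₀' − ϑ₀ ϑ₁'`. -/
def xiC (τ : ℂ) : ℂ := theta1C τ * deriv theta0C τ - theta0C τ * deriv theta1C τ

/-- Taylor coefficient `χ_{α,β}(τ)` of `φ(τ, z₁, z₂)` around `z₁ = z₂ = 0`. -/
def chiHJF (φ : ℂ → ℂ → ℂ → ℂ) (α β : ℕ) (τ : ℂ) : ℂ :=
  (1 / ((α.factorial : ℂ) * (β.factorial : ℂ))) *
    iteratedDeriv α (fun z₁ => iteratedDeriv β (fun z₂ => φ τ z₁ z₂) 0) 0

/-- `D₀ : J_{k,m} → M_k`, `ψ ↦ ψ(·, 0)`. -/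
def D0J (ψ : ℂ → ℂ → ℂ) : ℂ → ℂ := fun τ => ψ τ 0

/-- `D₂ : J_{k,m} → S_{k+2}`, `D₂ψ = (2k/(2πi)²) ψ₂ − (2m/(2πi)) ψ₀'`, where `ψ_ν` are
the Taylor coefficients of `ψ` around `z = 0`. -/
def D2J (k m : ℕ) (ψ : ℂ → ℂ → ℂ) : ℂ → ℂ := fun τ =>
  (2 * (k : ℂ) / (2 * (Real.pi : ℂ) * Complex.I) ^ 2) *
      ((1 / 2) * iteratedDeriv 2 (fun z => ψ τ z) 0)
    - (2 * (m : ℂ) / (2 * (Real.pi : ℂ) * Complex.I)) * deriv (fun t => ψ t 0) τ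

/-- Normalized Eisenstein series `E₄`. -/
def E4C (τ : ℂ) : ℂ :=
  1 + 240 * ∑' n : ℕ, ((ArithmeticFunction.sigma 3) n : ℂ) * eC ((n : ℂ) * τ)

/-- Normalized Eisenstein series `E₆`. -/
def E6C (τ : ℂ) : ℂ :=
  1 - 504 * ∑' n : ℕ, ((ArithmeticFunction.sigma 5) n : ℂ) * eC ((n : ℂ) * τ)

/-- `f` agrees on the upper half plane with a polynomial in `E₄` and `E₆²` that is
homogeneous of weight `k - v`, i.e. supported on `4a + 12b + v = k`. -/
def IsE4E6sqPoly (v k : ℕ) (f : ℂ → ℂ) : Prop :=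
  ∃ lam : ℕ × ℕ → ℂ, ∀ τ : ℂ, UHP τ →
    f τ = ∑ p ∈ (Finset.range (k + 1) ×ˢ Finset.range (k + 1)).filter
        (fun p => 4 * p.1 + 12 * p.2 + v = k),
      lam p * E4C τ ^ p.1 * E6C τ ^ (2 * p.2)

/-- The slash action `φ|_{k,m} M` of `M ∈ SL(2,ℤ)` on functions `ℂ → ℂ → ℂ → ℂ`. -/
def slashHJF (k m : ℕ) (φ : ℂ → ℂ → ℂ → ℂ) (M : Matrix.SpecialLinearGroup (Fin 2) ℤ)
    (τ z₁ z₂ : ℂ) : ℂ :=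
  ((Mc M * τ + Md M) ^ k)⁻¹ *
    eC (-(m : ℂ) * Mc M * z₁ * z₂ / (Mc M * τ + Md M)) *
    φ ((Ma M * τ + Mb M) / (Mc M * τ + Md M)) (z₁ / (Mc M * τ + Md M)) (z₂ / (Mc M * τ + Md M))

/-- Hermitian Jacobi form of weight `k` and index `m` for the congruence subgroup `Γ₀(N)`,
with at each cusp a Fourier expansion supported on `(n, r) ∈ ℚ_{≥0} × O_K^♯`
with `N(r) ≤ n m`. -/
structure IsHJFLevel (k m N : ℕ) (φ : ℂ → ℂ → ℂ → ℂ) : Prop where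
  holo : DifferentiableOn ℂ (fun p : ℂ × ℂ × ℂ => φ p.1 p.2.1 p.2.2) {p | UHP p.1}
  transf : ∀ ε : ℂ, ε ∈ ({1, -1, Complex.I, -Complex.I} : Set ℂ) →
    ∀ M : Matrix.SpecialLinearGroup (Fin 2) ℤ, (N : ℤ) ∣ M.1 1 0 →
    ∀ τ z₁ z₂ : ℂ, UHP τ →
      φ ((Ma M * τ + Mb M) / (Mc M * τ + Md M))
        (ε * z₁ / (Mc M * τ + Md M))
        ((starRingEnd ℂ) ε * z₂ / (Mc M * τ + Md M))
      = ε ^ k * (Mc M * τ + Md M) ^ k *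
          eC ((m : ℂ) * Mc M * z₁ * z₂ / (Mc M * τ + Md M)) * φ τ z₁ z₂
  ellip : ∀ p q u v : ℤ, ∀ τ z₁ z₂ : ℂ, UHP τ →
      φ τ (z₁ + ((p : ℂ) + (q : ℂ) * Complex.I) * τ + ((u : ℂ) + (v : ℂ) * Complex.I))
          (z₂ + ((p : ℂ) - (q : ℂ) * Complex.I) * τ + ((u : ℂ) - (v : ℂ) * Complex.I))
      = eC (-(m : ℂ) * (((p : ℂ) ^ 2 + (q : ℂ) ^ 2) * τ
          + ((p : ℂ) - (q : ℂ) * Complex.I) * z₁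
          + ((p : ℂ) + (q : ℂ) * Complex.I) * z₂)) * φ τ z₁ z₂
  cusp : ∀ M : Matrix.SpecialLinearGroup (Fin 2) ℤ,
      ∃ c : ℚ → ℤ → ℤ → ℂ,
        (∀ (n : ℚ) (a b : ℤ),
          ¬ (0 ≤ n ∧ ((a : ℚ) ^ 2 + (b : ℚ) ^ 2) ≤ 4 * n * m) → c n a b = 0) ∧
        ∀ τ z₁ z₂ : ℂ, UHP τ →
          HasSum (fun p : ℚ × ℤ × ℤ => c p.1 p.2.1 p.2.2 *
            eC ((p.1 : ℂ) * τ + (((p.2.1 : ℂ) + (p.2.2 : ℂ) * Complex.I) / 2) * z₁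
              + (((p.2.1 : ℂ) - (p.2.2 : ℂ) * Complex.I) / 2) * z₂))
            (slashHJF k m φ M τ z₁ z₂)

/-- Theta constant `x`. -/
def thConstX (τ : ℂ) : ℂ := ∑' n : ℤ, eC ((n : ℂ) ^ 2 * τ / 2)

/-- Theta constant `y`. -/
def thConstY (τ : ℂ) : ℂ := ∑' n : ℤ, (-1 : ℂ) ^ n * eC ((n : ℂ) ^ 2 * τ / 2)

/-- Theta constant `z`. -/
def thConstZ (τ : ℂ) : ℂ := ∑' n : ℤ, eC (((n : ℂ) + 1 / 2) ^ 2 * τ / 2)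

/-- The form `Φ_{4,2}`. -/
def Phi42 (τ z₁ z₂ : ℂ) : ℂ :=
  (thConstX τ ^ 6 + thConstY τ ^ 6) * (thetaH 2 0 0 τ z₁ z₂ + thetaH 2 2 2 τ z₁ z₂)
    + thConstZ τ ^ 6 * (thetaH 2 1 1 τ z₁ z₂ + thetaH 2 3 3 τ z₁ z₂
        + thetaH 2 1 3 τ z₁ z₂ + thetaH 2 3 1 τ z₁ z₂)
    + (thConstX τ ^ 6 - thConstY τ ^ 6) * (thetaH 2 0 2 τ z₁ z₂ + thetaH 2 2 0 τ z₁ z₂)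

/-- The form `Φ̃_{4,2}`. -/
def PhiTilde42 (τ z₁ z₂ : ℂ) : ℂ :=
  2 * thConstX τ ^ 3 * thConstY τ ^ 3 * (thetaH 2 0 0 τ z₁ z₂ - thetaH 2 2 2 τ z₁ z₂)
    + thConstZ τ ^ 3 * (thConstX τ ^ 3 - thConstY τ ^ 3) *
        (thetaH 2 0 1 τ z₁ z₂ + thetaH 2 1 0 τ z₁ z₂
          + thetaH 2 0 3 τ z₁ z₂ + thetaH 2 3 0 τ z₁ z₂)
    + thConstZ τ ^ 3 * (thConstX τ ^ 3 + thConstY τ ^ 3) *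
        (thetaH 2 1 2 τ z₁ z₂ + thetaH 2 2 1 τ z₁ z₂
          + thetaH 2 2 3 τ z₁ z₂ + thetaH 2 3 2 τ z₁ z₂)


lemma eC_add (a b : ℂ) : eC (a + b) = eC a * eC b := by
  simp only [eC, mul_add, Complex.exp_add]

lemma eC_ne (a : ℂ) : eC a ≠ 0 := Complex.exp_ne_zero _

lemma eC_zero : eC 0 = 1 := by simp [eC]

lemma eC_neg (a : ℂ) : eC (-a) = (eC a)⁻¹ := by
  simp [eC, Complex.exp_neg]

lemma eC_int (n : ℤ) : eC n = 1 := by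
  unfold eC
  rw [mul_comm]
  exact Complex.exp_int_mul_two_pi_mul_I n

lemma eC_add_int (a : ℂ) (n : ℤ) : eC (a + n) = eC a := by
  rw [eC_add, eC_int, mul_one]

lemma eC_one : eC 1 = 1 := by simpa using eC_int 1

lemma eC_half : eC (1 / 2) = -1 := by
  unfold eC
  rw [show 2 * (Real.pi : ℂ) * I * (1 / 2) = Real.pi * I by ring, Complex.exp_pi_mul_I]

lemma eC_nat_mul (n : ℕ) (a : ℂ) : eC (n * a) = eC a ^ n := by
  unfold eC
  rw [← Complex.exp_nat_mul]; congr 1; ring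

lemma norm_eC (a : ℂ) : ‖eC a‖ = Real.exp (-2 * Real.pi * a.im) := by
  unfold eC
  rw [Complex.norm_exp]
  congr 1
  simp

/-- one-variable theta functions -/
def th (a : ℤ) (τ u : ℂ) : ℂ :=
  ∑' g : ℤ, eC (((a : ℂ) + 4 * g) ^ 2 / 8 * τ + ((a : ℂ) + 4 * g) * u)

def TX (τ u : ℂ) : ℂ := jacobiTheta₂ (2 * u) τ
def TY (τ u : ℂ) : ℂ := jacobiTheta₂ (2 * u + 1 / 2) τ
def TZ (τ u : ℂ) : ℂ := eC (τ / 8 + u) * jacobiTheta₂ (2 * u + τ / 2) τ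

lemma hasSum_th (a : ℤ) {τ : ℂ} (hτ : UHP τ) (u : ℂ) :
    HasSum (fun g : ℤ => eC (((a : ℂ) + 4 * g) ^ 2 / 8 * τ + ((a : ℂ) + 4 * g) * u)) (th a τ u) := by
  apply Summable.hasSum
  have h4 : 0 < (4 * τ).im := by simpa [UHP] using hτ
  have := ((summable_jacobiTheta₂_term_iff (a * τ + 4 * u) (4 * τ)).2 h4).mul_left
    (eC ((a : ℂ) ^ 2 / 8 * τ + a * u))
  refine this.congr fun g => ?_
  simp only [eC, jacobiTheta₂_term, ← Complex.exp_add]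
  congr 1
  ring

lemma hasSum_TX {τ : ℂ} (hτ : UHP τ) (u : ℂ) :
    HasSum (fun n : ℤ => eC ((n : ℂ) ^ 2 * τ / 2 + 2 * n * u)) (TX τ u) := by
  refine (hasSum_jacobiTheta₂_term (2 * u) hτ).congr_fun ?_ 
  intro n
  simp only [eC, jacobiTheta₂_term]
  congr 1
  ring

lemma hasSum_TY {τ : ℂ} (hτ : UHP τ) (u : ℂ) :
    HasSum (fun n : ℤ => (-1 : ℂ) ^ n * eC ((n : ℂ) ^ 2 * τ / 2 + 2 * n * u)) (TY τ u) := by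
  refine (hasSum_jacobiTheta₂_term (2 * u + 1 / 2) hτ).congr_fun ?_
  intro n
  rw [← eC_half]
  simp only [eC, jacobiTheta₂_term, ← Complex.exp_int_mul, ← Complex.exp_add]
  congr 1
  ring

lemma hasSum_TZ {τ : ℂ} (hτ : UHP τ) (u : ℂ) :
    HasSum (fun n : ℤ => eC (((n : ℂ) + 1 / 2) ^ 2 * τ / 2 + (2 * n + 1) * u)) (TZ τ u) := by
  refine ((hasSum_jacobiTheta₂_term (2 * u + τ / 2) hτ).mul_left (eC (τ / 8 + u))).congr_fun ?_
  intro n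
  simp only [eC, jacobiTheta₂_term, ← Complex.exp_add]
  congr 1
  ring


lemma hasSum_int_even_odd {f : ℤ → ℂ} {m m' : ℂ} (he : HasSum (fun k => f (2 * k)) m)
    (ho : HasSum (fun k => f (2 * k + 1)) m') : HasSum f (m + m') := by
  have h2 := mul_right_injective₀ (two_ne_zero' ℤ)
  replace ho := ((add_left_injective 1).comp h2).hasSum_range_iff.2 ho
  refine (h2.hasSum_range_iff.2 he).add_isCompl ?_ ho
  simpa [Function.comp_def] using Int.isCompl_even_odd

lemma TX_eq {τ : ℂ} (hτ : UHP τ) (u : ℂ) : TX τ u = th 0 τ u + th 2 τ u := by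
  refine (hasSum_TX hτ u).unique (hasSum_int_even_odd ?_ ?_)
  · refine (hasSum_th 0 hτ u).congr_fun fun g => ?_
    push_cast; ring_nf
  · refine (hasSum_th 2 hτ u).congr_fun fun g => ?_
    push_cast; ring_nf

lemma TY_eq {τ : ℂ} (hτ : UHP τ) (u : ℂ) : TY τ u = th 0 τ u - th 2 τ u := by
  rw [sub_eq_add_neg]
  refine (hasSum_TY hτ u).unique (hasSum_int_even_odd ?_ ?_)
  · refine (hasSum_th 0 hτ u).congr_fun fun g => ?_
    rw [zpow_mul]; norm_num
    ring_nf
  · refine (hasSum_th 2 hτ u).neg.congr_fun fun g => ?_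
    rw [zpow_add₀ (by norm_num), zpow_mul]; norm_num
    ring_nf

lemma TZ_eq {τ : ℂ} (hτ : UHP τ) (u : ℂ) : TZ τ u = th 1 τ u + th 3 τ u := by
  refine (hasSum_TZ hτ u).unique (hasSum_int_even_odd ?_ ?_)
  · refine (hasSum_th 1 hτ u).congr_fun fun g => ?_
    push_cast; ring_nf
  · refine (hasSum_th 3 hτ u).congr_fun fun g => ?_
    push_cast; ring_nf

lemma thConstX_eq {τ : ℂ} (hτ : UHP τ) : thConstX τ = TX τ 0 := by
  rw [thConstX, ← (hasSum_TX hτ 0).tsum_eq]; simp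

lemma thConstY_eq {τ : ℂ} (hτ : UHP τ) : thConstY τ = TY τ 0 := by
  rw [thConstY, ← (hasSum_TY hτ 0).tsum_eq]; simp

lemma thConstZ_eq {τ : ℂ} (hτ : UHP τ) : thConstZ τ = TZ τ 0 := by
  rw [thConstZ, ← (hasSum_TZ hτ 0).tsum_eq]; simp

lemma thetaH_eq (a b : ℤ) {τ : ℂ} (hτ : UHP τ) (z₁ z₂ : ℂ) :
    thetaH 2 a b τ z₁ z₂ = th a τ ((z₁ + z₂) / 2) * th b τ (I * (z₁ - z₂) / 2) := by
  unfold th thetaH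
  rw [tsum_mul_tsum_of_summable_norm (hasSum_th a hτ _).summable.norm
    (hasSum_th b hτ _).summable.norm]
  refine tsum_congr fun g => ?_
  rw [← eC_add]
  congr 1
  push_cast
  ring

/-- the forms in product shape -/
def G1 (τ u v : ℂ) : ℂ :=
  TX τ 0 ^ 6 * (TX τ u * TX τ v) + TY τ 0 ^ 6 * (TY τ u * TY τ v) + TZ τ 0 ^ 6 * (TZ τ u * TZ τ v)

def G2 (τ u v : ℂ) : ℂ :=
  TX τ 0 ^ 3 * TY τ 0 ^ 3 * (TX τ u * TY τ v + TY τ u * TX τ v)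
  + TX τ 0 ^ 3 * TZ τ 0 ^ 3 * (TX τ u * TZ τ v + TZ τ u * TX τ v)
  - TY τ 0 ^ 3 * TZ τ 0 ^ 3 * (TY τ u * TZ τ v + TZ τ u * TY τ v)

lemma Phi42_eq {τ : ℂ} (hτ : UHP τ) (z₁ z₂ : ℂ) :
    Phi42 τ z₁ z₂ = G1 τ ((z₁ + z₂) / 2) (I * (z₁ - z₂) / 2) := by
  unfold Phi42 G1
  simp only [thetaH_eq _ _ hτ, thConstX_eq hτ, thConstY_eq hτ, thConstZ_eq hτ]
  generalize TX τ 0 = x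
  generalize TY τ 0 = y
  generalize TZ τ 0 = z
  simp only [TX_eq hτ, TY_eq hτ, TZ_eq hτ]
  ring

lemma PhiTilde42_eq {τ : ℂ} (hτ : UHP τ) (z₁ z₂ : ℂ) :
    PhiTilde42 τ z₁ z₂ = G2 τ ((z₁ + z₂) / 2) (I * (z₁ - z₂) / 2) := by
  unfold PhiTilde42 G2
  simp only [thetaH_eq _ _ hτ, thConstX_eq hτ, thConstY_eq hτ, thConstZ_eq hτ]
  generalize TX τ 0 = x
  generalize TY τ 0 = y
  generalize TZ τ 0 = z
  simp only [TX_eq hτ, TY_eq hτ, TZ_eq hτ]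
  ring

/-! transformation laws -/

lemma jac_add_one (z τ : ℂ) : jacobiTheta₂ z (τ + 1) = jacobiTheta₂ (z + 1 / 2) τ := by
  refine tsum_congr fun n => ?_
  simp only [jacobiTheta₂_term]
  obtain ⟨k, hk⟩ := Int.even_or_odd' n
  have : ((n : ℂ) ^ 2 - n) / 2 = ((n * (n - 1) / 2 : ℤ) : ℂ) := by
    have h2 : 2 ∣ n * (n - 1) := by
      rcases hk with h | h
      · exact ⟨k * (n - 1), by rw [h]; ring⟩
      · exact ⟨n * k, by rw [h]; ring⟩
    rw [Int.cast_div h2 (by norm_num)]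
    push_cast; ring
  rw [show 2 * (Real.pi : ℂ) * I * n * z + Real.pi * I * n ^ 2 * (τ + 1) =
    (2 * (Real.pi : ℂ) * I * n * (z + 1 / 2) + Real.pi * I * n ^ 2 * τ)
      + (((n : ℂ) ^ 2 - n) / 2) * (2 * Real.pi * I) by ring, this, Complex.exp_add,
      Complex.exp_int_mul_two_pi_mul_I, mul_one]

lemma TX_T (τ u : ℂ) : TX (τ + 1) u = TY τ u := by simp only [TX, TY, jac_add_one]

lemma TY_T (τ u : ℂ) : TY (τ + 1) u = TX τ u := by
  simp only [TX, TY, jac_add_one]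
  rw [← jacobiTheta₂_add_left (2 * u)]; congr 1; ring

lemma TZ_T (τ u : ℂ) : TZ (τ + 1) u = eC (1 / 8) * TZ τ u := by
  simp only [TZ, jac_add_one]
  rw [← jacobiTheta₂_add_left (2 * u + τ / 2), ← mul_assoc, ← eC_add]; congr 2 <;> ring

/-- square root factor -/
def sqf (τ : ℂ) : ℂ := (-I * τ) ^ (1 / 2 : ℂ)

lemma UHP.ne {τ : ℂ} (h : UHP τ) : τ ≠ 0 := by
  rintro rfl; simp [UHP] at h

lemma sqf_sq {τ : ℂ} : sqf τ ^ 2 = -I * τ := by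
  unfold sqf
  rw [← Complex.cpow_nat_mul]; norm_num

lemma sqf_ne {τ : ℂ} (h : UHP τ) : sqf τ ≠ 0 := by
  intro h0
  have := sqf_sq (τ := τ)
  rw [h0] at this
  simp [h.ne] at this

lemma jac_S {τ : ℂ} (h : UHP τ) (z : ℂ) :
    jacobiTheta₂ (z / τ) (-1 / τ) = sqf τ * (eC (z ^ 2 / (2 * τ)) * jacobiTheta₂ z τ) := by
  have := jacobiTheta₂_functional_equation z τ
  have h1 : eC (z ^ 2 / (2 * τ)) * cexp (-Real.pi * I * z ^ 2 / τ) = 1 := by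
    rw [eC, ← Complex.exp_add, ← Complex.exp_zero]
    congr 1
    field_simp [h.ne]
    ring
  have h2 := sqf_ne h
  rw [this, ← sqf]
  calc _ = (sqf τ * (1 / sqf τ)) * (eC (z ^ 2 / (2 * τ)) * cexp (-Real.pi * I * z ^ 2 / τ)) *
        jacobiTheta₂ (z / τ) (-1 / τ) := by rw [h1]; field_simp
    _ = _ := by ring

lemma TX_S {τ : ℂ} (h : UHP τ) (u : ℂ) :
    TX (-1 / τ) (u / τ) = sqf τ * eC (2 * u ^ 2 / τ) * TX τ u := by
  simp only [TX]
  rw [← mul_div_assoc, jac_S h, mul_assoc]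
  congr 3
  field_simp [h.ne]

lemma TY_S {τ : ℂ} (h : UHP τ) (u : ℂ) :
    TY (-1 / τ) (u / τ) = sqf τ * eC (2 * u ^ 2 / τ) * TZ τ u := by
  simp only [TY, TZ]
  rw [show 2 * (u / τ) + 1 / 2 = (2 * u + τ / 2) / τ by field_simp [h.ne], jac_S h, mul_assoc,
    ← mul_assoc (eC _) (eC _), ← eC_add]
  congr 3
  field_simp [h.ne]; ring

lemma TZ_S {τ : ℂ} (h : UHP τ) (u : ℂ) :
    TZ (-1 / τ) (u / τ) = sqf τ * eC (2 * u ^ 2 / τ) * TY τ u := by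
  simp only [TY, TZ]
  rw [show 2 * (u / τ) + -1 / τ / 2 = (2 * u - 1 / 2) / τ by field_simp [h.ne]; ring, jac_S h,
    show jacobiTheta₂ (2 * u + 1 / 2) τ = jacobiTheta₂ (2 * u - 1 / 2) τ by
      rw [← jacobiTheta₂_add_left (2 * u - 1 / 2)]; congr 1; ring]
  rw [show ∀ a b c d : ℂ, a * (b * (c * d)) = b * (a * c) * d by intros; ring, ← eC_add]
  congr 3
  field_simp [h.ne]; ring

lemma TX_S0 {τ : ℂ} (h : UHP τ) : TX (-1 / τ) 0 = sqf τ * TX τ 0 := by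
  simpa [eC_zero] using TX_S h 0
lemma TY_S0 {τ : ℂ} (h : UHP τ) : TY (-1 / τ) 0 = sqf τ * TZ τ 0 := by
  simpa [eC_zero] using TY_S h 0
lemma TZ_S0 {τ : ℂ} (h : UHP τ) : TZ (-1 / τ) 0 = sqf τ * TY τ 0 := by
  simpa [eC_zero] using TZ_S h 0

lemma TX_neg (τ u : ℂ) : TX τ (-u) = TX τ u := by
  simp only [TX, mul_neg, jacobiTheta₂_neg_left]

lemma TY_neg (τ u : ℂ) : TY τ (-u) = TY τ u := by
  simp only [TY]
  rw [← jacobiTheta₂_neg_left, ← jacobiTheta₂_add_left]; congr 1; ring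

lemma th_ell (a p s : ℤ) (τ u : ℂ) :
    th a τ (u + p * τ + s) = eC (-2 * (p ^ 2 * τ + 2 * p * u)) * th a τ u := by
  unfold th
  rw [← tsum_mul_left, ← (Equiv.subRight p).tsum_eq]
  refine tsum_congr fun g => ?_
  rw [← eC_add, ← eC_add_int _ (-((a + 4 * (g - p)) * s))]
  congr 1
  simp only [Equiv.subRight_apply]
  push_cast
  ring

lemma th_neg (a : ℤ) (τ u : ℂ) : th a τ (-u) = th (-a) τ u := by
  unfold th
  rw [← (Equiv.neg ℤ).tsum_eq]
  refine tsum_congr fun g => ?_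
  congr 1
  simp only [Equiv.neg_apply]
  push_cast
  ring

lemma th_add4 (a : ℤ) (τ u : ℂ) : th (a + 4) τ u = th a τ u := by
  unfold th
  rw [← (Equiv.subRight (1 : ℤ)).tsum_eq]
  refine tsum_congr fun g => ?_
  congr 1
  simp only [Equiv.subRight_apply]
  push_cast
  ring

lemma TZ_neg {τ : ℂ} (h : UHP τ) (u : ℂ) : TZ τ (-u) = TZ τ u := by
  rw [TZ_eq h, TZ_eq h, th_neg, th_neg, ← th_add4 (-1), ← th_add4 (-3), add_comm]
  norm_num

lemma TX_ell (p s : ℤ) {τ : ℂ} (h : UHP τ) (u : ℂ) :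
    TX τ (u + p * τ + s) = eC (-2 * (p ^ 2 * τ + 2 * p * u)) * TX τ u := by
  simp only [TX_eq h, th_ell]; ring
lemma TY_ell (p s : ℤ) {τ : ℂ} (h : UHP τ) (u : ℂ) :
    TY τ (u + p * τ + s) = eC (-2 * (p ^ 2 * τ + 2 * p * u)) * TY τ u := by
  simp only [TY_eq h, th_ell]; ring
lemma TZ_ell (p s : ℤ) {τ : ℂ} (h : UHP τ) (u : ℂ) :
    TZ τ (u + p * τ + s) = eC (-2 * (p ^ 2 * τ + 2 * p * u)) * TZ τ u := by
  simp only [TZ_eq h, th_ell]; ring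

/-! differentiability -/
lemma diff_TX {E : Type*} [NormedAddCommGroup E] [NormedSpace ℂ E] {f g : E → ℂ} {p : E}
    (hf : DifferentiableAt ℂ f p) (hg : DifferentiableAt ℂ g p) (h : UHP (f p)) :
    DifferentiableAt ℂ (fun q => TX (f q) (g q)) p := by
  have := (hasFDerivAt_jacobiTheta₂ (2 * g p) h).differentiableAt
  exact DifferentiableAt.comp (f := fun q => (2 * g q, f q)) p this
    ((hg.const_mul 2).prodMk hf)

lemma diff_TY {E : Type*} [NormedAddCommGroup E] [NormedSpace ℂ E] {f g : E → ℂ} {p : E}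
    (hf : DifferentiableAt ℂ f p) (hg : DifferentiableAt ℂ g p) (h : UHP (f p)) :
    DifferentiableAt ℂ (fun q => TY (f q) (g q)) p := by
  have := (hasFDerivAt_jacobiTheta₂ (2 * g p + 1 / 2) h).differentiableAt
  exact DifferentiableAt.comp (f := fun q => (2 * g q + 1 / 2, f q)) p this
    (((hg.const_mul 2).add_const _).prodMk hf)

lemma diff_TZ {E : Type*} [NormedAddCommGroup E] [NormedSpace ℂ E] {f g : E → ℂ} {p : E}
    (hf : DifferentiableAt ℂ f p) (hg : DifferentiableAt ℂ g p) (h : UHP (f p)) :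
    DifferentiableAt ℂ (fun q => TZ (f q) (g q)) p := by
  have := (hasFDerivAt_jacobiTheta₂ (2 * g p + f p / 2) h).differentiableAt
  have h2 := DifferentiableAt.comp (f := fun q => (2 * g q + f q / 2, f q)) p this
    (by fun_prop)
  have h3 : DifferentiableAt ℂ (fun q => eC (f q / 8 + g q)) p := by
    unfold eC; fun_prop
  exact h3.mul h2


/-- abstract Fourier representability -/
def RepP (P : ℤ → ℤ → ℤ → Prop) (F : ℂ → ℂ → ℂ → ℂ) : Prop :=
  ∃ (ι : Type) (c : ι → ℂ) (N a b : ι → ℤ), (∀ i, P (N i) (a i) (b i)) ∧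
    ∀ τ u v : ℂ, UHP τ → HasSum (fun i => c i * eC ((N i : ℂ) / 8 * τ + a i * u + b i * v)) (F τ u v)

lemma RepP.mul {P Q R : ℤ → ℤ → ℤ → Prop} {F G : ℂ → ℂ → ℂ → ℂ}
    (h : ∀ N a b N' a' b', P N a b → Q N' a' b' → R (N + N') (a + a') (b + b'))
    (hF : RepP P F) (hG : RepP Q G) : RepP R (fun τ u v => F τ u v * G τ u v) := by
  obtain ⟨ι, c, N, a, b, hP, hs⟩ := hF
  obtain ⟨ι', c', N', a', b', hP', hs'⟩ := hG
  refine ⟨ι × ι', fun i => c i.1 * c' i.2, fun i => N i.1 + N' i.2, fun i => a i.1 + a' i.2,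
    fun i => b i.1 + b' i.2, fun i => h _ _ _ _ _ _ (hP _) (hP' _), fun τ u v hτ => ?_⟩
  have h1 := hs τ u v hτ
  have h2 := hs' τ u v hτ
  have hsm : Summable fun x : ι × ι' => (c x.1 * eC ((N x.1 : ℂ) / 8 * τ + a x.1 * u + b x.1 * v)) *
      (c' x.2 * eC ((N' x.2 : ℂ) / 8 * τ + a' x.2 * u + b' x.2 * v)) :=
    summable_mul_of_summable_norm (f := fun i => c i * eC ((N i : ℂ) / 8 * τ + a i * u + b i * v))
      (g := fun i => c' i * eC ((N' i : ℂ) / 8 * τ + a' i * u + b' i * v))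
      h1.summable.norm h2.summable.norm
  have h3 := h1.mul h2 hsm
  have key : ∀ i : ι × ι', c i.1 * c' i.2 * eC (((N i.1 + N' i.2 : ℤ) : ℂ) / 8 * τ +
      ((a i.1 + a' i.2 : ℤ) : ℂ) * u + ((b i.1 + b' i.2 : ℤ) : ℂ) * v) =
      (c i.1 * eC ((N i.1 : ℂ) / 8 * τ + a i.1 * u + b i.1 * v)) *
      (c' i.2 * eC ((N' i.2 : ℂ) / 8 * τ + a' i.2 * u + b' i.2 * v)) := by
    intro i
    have e : ((N i.1 + N' i.2 : ℤ) : ℂ) / 8 * τ +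
      ((a i.1 + a' i.2 : ℤ) : ℂ) * u + ((b i.1 + b' i.2 : ℤ) : ℂ) * v =
      ((N i.1 : ℂ) / 8 * τ + a i.1 * u + b i.1 * v) + ((N' i.2 : ℂ) / 8 * τ + a' i.2 * u + b' i.2 * v) := by
      push_cast; ring
    rw [e, eC_add]; ring
  simp only [key]
  exact h3

lemma RepP.add {P : ℤ → ℤ → ℤ → Prop} {F G : ℂ → ℂ → ℂ → ℂ}
    (hF : RepP P F) (hG : RepP P G) : RepP P (fun τ u v => F τ u v + G τ u v) := by
  obtain ⟨ι, c, N, a, b, hP, hs⟩ := hF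
  obtain ⟨ι', c', N', a', b', hP', hs'⟩ := hG
  refine ⟨ι ⊕ ι', Sum.elim c c', Sum.elim N N', Sum.elim a a', Sum.elim b b', ?_,
    fun τ u v hτ => ?_⟩
  · rintro (i | i)
    · exact hP i
    · exact hP' i
  · exact HasSum.sum (hs τ u v hτ) (hs' τ u v hτ)

lemma RepP.neg {P : ℤ → ℤ → ℤ → Prop} {F : ℂ → ℂ → ℂ → ℂ}
    (hF : RepP P F) : RepP P (fun τ u v => -F τ u v) := by
  obtain ⟨ι, c, N, a, b, hP, hs⟩ := hF
  refine ⟨ι, fun i => -c i, N, a, b, hP, fun τ u v hτ => ?_⟩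
  refine (hs τ u v hτ).neg.congr_fun fun i => ?_
  ring

def Q0' (N a b : ℤ) : Prop := 0 ≤ N ∧ a = 0 ∧ b = 0
def QA (N a b : ℤ) : Prop := a ^ 2 ≤ N ∧ b = 0
def QB (N a b : ℤ) : Prop := b ^ 2 ≤ N ∧ a = 0
def QQ (N a b : ℤ) : Prop := a ^ 2 + b ^ 2 ≤ N

lemma rep_gen {Θ : ℂ → ℂ → ℂ} (c : ℤ → ℂ) (m : ℤ → ℤ)
    (h : ∀ τ u, UHP τ → HasSum (fun n => c n * eC ((m n : ℂ) ^ 2 / 8 * τ + m n * u)) (Θ τ u)) :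
    RepP Q0' (fun τ _ _ => Θ τ 0) ∧ RepP QA (fun τ u _ => Θ τ u) ∧ RepP QB (fun τ _ v => Θ τ v) := by
  refine ⟨⟨ℤ, c, fun n => m n ^ 2, fun _ => 0, fun _ => 0, fun n => ⟨sq_nonneg _, rfl, rfl⟩, ?_⟩,
    ⟨ℤ, c, fun n => m n ^ 2, m, fun _ => 0, fun n => ⟨le_rfl, rfl⟩, ?_⟩,
    ⟨ℤ, c, fun n => m n ^ 2, fun _ => 0, m, fun n => ⟨le_rfl, rfl⟩, ?_⟩⟩ <;> intro τ u v hτ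
  · simpa using h τ 0 hτ
  · simpa using h τ u hτ
  · simpa using h τ v hτ

lemma rep_X : RepP Q0' (fun τ _ _ => TX τ 0) ∧ RepP QA (fun τ u _ => TX τ u) ∧
    RepP QB (fun τ _ v => TX τ v) := by
  refine rep_gen (fun _ => 1) (fun n => 2 * n) fun τ u hτ => ?_
  refine (hasSum_TX hτ u).congr_fun fun n => ?_
  push_cast; ring_nf

lemma rep_Y : RepP Q0' (fun τ _ _ => TY τ 0) ∧ RepP QA (fun τ u _ => TY τ u) ∧
    RepP QB (fun τ _ v => TY τ v) := by
  refine rep_gen (fun n => (-1) ^ n) (fun n => 2 * n) fun τ u hτ => ?_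
  refine (hasSum_TY hτ u).congr_fun fun n => ?_
  push_cast; ring_nf

lemma rep_Z : RepP Q0' (fun τ _ _ => TZ τ 0) ∧ RepP QA (fun τ u _ => TZ τ u) ∧
    RepP QB (fun τ _ v => TZ τ v) := by
  refine rep_gen (fun _ => 1) (fun n => 2 * n + 1) fun τ u hτ => ?_
  refine (hasSum_TZ hτ u).congr_fun fun n => ?_
  push_cast; ring_nf

lemma RepP.mul0 {F G : ℂ → ℂ → ℂ → ℂ} (hF : RepP Q0' F) (hG : RepP Q0' G) :
    RepP Q0' (fun τ u v => F τ u v * G τ u v) := by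
  refine hF.mul ?_ hG
  rintro N a b N' a' b' ⟨h, rfl, rfl⟩ ⟨h', rfl, rfl⟩
  exact ⟨by positivity, rfl, rfl⟩

lemma RepP.mulQ {F G : ℂ → ℂ → ℂ → ℂ} (hF : RepP Q0' F) (hG : RepP QQ G) :
    RepP QQ (fun τ u v => F τ u v * G τ u v) := by
  refine hF.mul ?_ hG
  rintro N a b N' a' b' ⟨h, rfl, rfl⟩ h'
  unfold QQ at *
  simp only [zero_add]; linarith

lemma RepP.mulAB {F G : ℂ → ℂ → ℂ → ℂ} (hF : RepP QA F) (hG : RepP QB G) :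
    RepP QQ (fun τ u v => F τ u v * G τ u v) := by
  refine hF.mul ?_ hG
  rintro N a b N' a' b' ⟨h, rfl⟩ ⟨h', rfl⟩
  unfold QQ
  simp only [zero_add, add_zero]; linarith

lemma RepP.congr' {P : ℤ → ℤ → ℤ → Prop} {F G : ℂ → ℂ → ℂ → ℂ} (hF : RepP P F)
    (h : ∀ τ u v, G τ u v = F τ u v) : RepP P G := by
  have : G = F := by funext τ u v; exact h τ u v
  rwa [this]

lemma RepP.pow3 {F : ℂ → ℂ → ℂ → ℂ} (hF : RepP Q0' F) :
    RepP Q0' (fun τ u v => F τ u v ^ 3) :=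
  ((hF.mul0 hF).mul0 hF).congr' fun τ u v => by ring

lemma rep_G1 : RepP QQ G1 := by
  have h6 : ∀ {F : ℂ → ℂ → ℂ → ℂ}, RepP Q0' F → RepP Q0' (fun τ u v => F τ u v ^ 6) :=
    fun hF => (hF.pow3.mul0 hF.pow3).congr' fun τ u v => by ring
  exact (((h6 rep_X.1).mulQ (rep_X.2.1.mulAB rep_X.2.2)).add
    ((h6 rep_Y.1).mulQ (rep_Y.2.1.mulAB rep_Y.2.2))).add
    ((h6 rep_Z.1).mulQ (rep_Z.2.1.mulAB rep_Z.2.2))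

lemma rep_G2 : RepP QQ G2 := by
  have hx := rep_X
  have hy := rep_Y
  have hz := rep_Z
  refine ((((hx.1.pow3.mul0 hy.1.pow3).mulQ ((hx.2.1.mulAB hy.2.2).add (hy.2.1.mulAB hx.2.2))).add
    ((hx.1.pow3.mul0 hz.1.pow3).mulQ ((hx.2.1.mulAB hz.2.2).add (hz.2.1.mulAB hx.2.2)))).add
    ((hy.1.pow3.mul0 hz.1.pow3).mulQ ((hy.2.1.mulAB hz.2.2).add (hz.2.1.mulAB hy.2.2))).neg).congr'
    fun τ u v => ?_
  unfold G2; ring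

lemma sum_eC8 (N : ℤ) : ∑ j ∈ Finset.range 8, eC ((N : ℂ) / 8 * (j : ℂ)) = if 8 ∣ N then 8 else 0 := by
  have hw : ∀ j : ℕ, eC ((N : ℂ) / 8 * (j : ℂ)) = eC ((N : ℂ) / 8) ^ j := fun j => by
    rw [mul_comm, eC_nat_mul]
  simp only [hw]
  split_ifs with h
  · obtain ⟨k, rfl⟩ := h
    have : (((8 * k : ℤ) : ℂ) / 8) = k := by push_cast; ring
    rw [this, eC_int]; simp
  · have h1 : eC ((N : ℂ) / 8) ≠ 1 := by
      intro h1
      apply h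
      rw [eC, Complex.exp_eq_one_iff] at h1
      obtain ⟨k, hk⟩ := h1
      refine ⟨k, ?_⟩
      have h2 : (2 * (Real.pi : ℂ) * I) ≠ 0 := Complex.two_pi_I_ne_zero
      rw [mul_comm (k : ℂ)] at hk
      have := mul_left_cancel₀ h2 hk
      have h3 : (N : ℂ) = ((8 * k : ℤ) : ℂ) := by push_cast; rw [← this]; ring
      exact_mod_cast h3
    have h8 : eC ((N : ℂ) / 8) ^ 8 = 1 := by
      rw [← hw]
      have : ((N : ℂ) / 8 * ((8 : ℕ) : ℂ)) = N := by push_cast; ring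
      rw [this, eC_int]
    rw [geom_sum_eq h1, h8]; simp

lemma UHP.add_nat {τ : ℂ} (h : UHP τ) (j : ℕ) : UHP (τ + j) := by simpa [UHP] using h

lemma rep_fourier {G : ℂ → ℂ → ℂ → ℂ} (hG : RepP QQ G)
    (hT : ∀ τ u v, UHP τ → G (τ + 1) u v = G τ u v) :
    ∃ c : ℕ → ℤ → ℤ → ℂ,
      (∀ (n : ℕ) (a b : ℤ), 8 * (n : ℤ) < a ^ 2 + b ^ 2 → c n a b = 0) ∧
      ∀ τ u v : ℂ, UHP τ →
        HasSum (fun p : ℕ × ℤ × ℤ => c p.1 p.2.1 p.2.2 *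
          eC ((p.1 : ℂ) * τ + p.2.1 * u + p.2.2 * v)) (G τ u v) := by
  obtain ⟨ι, c, N, a, b, hQ, hs⟩ := hG
  have hTj : ∀ (j : ℕ) (τ u v : ℂ), UHP τ → G (τ + j) u v = G τ u v := by
    intro j τ u v hτ
    induction j with
    | zero => simp
    | succ j ih => rw [← ih, ← hT _ u v (hτ.add_nat j)]; congr 1; push_cast; ring
  set c' : ι → ℂ := fun i => if 8 ∣ N i then c i else 0 with hc'
  have hs' : ∀ τ u v : ℂ, UHP τ →
      HasSum (fun i => c' i * eC ((N i : ℂ) / 8 * τ + a i * u + b i * v)) (G τ u v) := by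
    intro τ u v hτ
    have h1 := hasSum_sum (f := fun (j : ℕ) i => c i * eC ((N i : ℂ) / 8 * (τ + j) + a i * u + b i * v))
      (a := fun j : ℕ => G (τ + j) u v) (s := Finset.range 8)
      (fun j _ => hs (τ + j) u v (hτ.add_nat j))
    simp only [hTj _ _ _ _ hτ] at h1
    have h2 := h1.mul_left (1 / 8)
    rw [Finset.sum_const, Finset.card_range] at h2
    have h3 : (1 / 8 : ℂ) * (8 • G τ u v) = G τ u v := by simp
    rw [h3] at h2
    refine h2.congr_fun fun i => ?_
    have : ∀ j : ℕ, c i * eC ((N i : ℂ) / 8 * (τ + j) + a i * u + b i * v) =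
        c i * eC ((N i : ℂ) / 8 * τ + a i * u + b i * v) * eC ((N i : ℂ) / 8 * j) := by
      intro j
      rw [mul_assoc, ← eC_add]; congr 2; ring
    simp only [this, ← Finset.mul_sum, sum_eC8, hc']
    split_ifs <;> ring
  set κ : ι → ℕ × ℤ × ℤ := fun i => ((N i / 8).toNat, a i, b i) with hκ
  refine ⟨fun n a b => ∑' i : {i // κ i = (n, a, b)}, c' i, ?_, ?_⟩
  · intro n a' b' h
    have : ∀ i : {i // κ i = (n, a', b')}, c' i = 0 := by
      rintro ⟨i, hi⟩
      simp only [hc']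
      split_ifs with h8
      · exfalso
        simp only [hκ, Prod.mk.injEq] at hi
        obtain ⟨h1, rfl, rfl⟩ := hi
        have := hQ i
        unfold QQ at this
        have : 0 ≤ N i := le_trans (by positivity) this
        omega
      · rfl
    simp [this]
  · intro τ u v hτ
    have h1 := (Equiv.sigmaFiberEquiv κ).hasSum_iff.2 (hs' τ u v hτ)
    have key : ∀ (p : ℕ × ℤ × ℤ) (i : {i // κ i = p}),
        c' i * eC ((N i : ℂ) / 8 * τ + a i * u + b i * v) =
        c' i * eC ((p.1 : ℂ) * τ + p.2.1 * u + p.2.2 * v) := by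
      rintro p ⟨i, rfl⟩
      simp only [hc', hκ]
      split_ifs with h8
      · have h0 := hQ i
        unfold QQ at h0
        have h0 : 0 ≤ N i := le_trans (by positivity) h0
        obtain ⟨k, hk⟩ := h8
        have hk' : (((N i / 8).toNat : ℕ) : ℂ) = k := by
          have : ((N i / 8).toNat : ℤ) = k := by omega
          exact_mod_cast this
        have hN : (N i : ℂ) / 8 = k := by rw [hk]; push_cast; ring
        rw [hk', hN]
      · simp
    refine h1.sigma fun p => ?_
    have h2 := h1.summable.sigma_factor p
    have h3 := h2.hasSum
    simp only [Function.comp_apply, Equiv.sigmaFiberEquiv, Equiv.coe_fn_mk] at h3 ⊢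
    simp only [key] at h3 ⊢
    rw [tsum_mul_right] at h3
    exact h3


abbrev SLZ := Matrix.SpecialLinearGroup (Fin 2) ℤ

lemma mob_coe (M : SLZ) {τ : ℂ} (hτ : UHP τ) :
    ((M • (⟨τ, hτ⟩ : UpperHalfPlane) : UpperHalfPlane) : ℂ) = (Ma M * τ + Mb M) / (Mc M * τ + Md M) := by
  rw [UpperHalfPlane.coe_specialLinearGroup_apply]
  simp [Ma, Mb, Mc, Md]

lemma mob_UHP (M : SLZ) {τ : ℂ} (hτ : UHP τ) : UHP ((Ma M * τ + Mb M) / (Mc M * τ + Md M)) := by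
  rw [← mob_coe M hτ]; exact UpperHalfPlane.im_pos _

lemma mob_ne (M : SLZ) {τ : ℂ} (hτ : UHP τ) : Mc M * τ + Md M ≠ 0 := by
  have := UpperHalfPlane.denom_ne_zero (M : Matrix.GeneralLinearGroup (Fin 2) ℝ) ⟨τ, hτ⟩
  simpa [UpperHalfPlane.denom, Mc, Md] using this

lemma M_det (M : SLZ) : Ma M * Md M - Mb M * Mc M = 1 := by
  have := M.2
  rw [Matrix.det_fin_two] at this
  unfold Ma Mb Mc Md
  exact_mod_cast this

lemma Ma_mul (M N : SLZ) : Ma (M * N) = Ma M * Ma N + Mb M * Mc N := by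
  simp [Ma, Mb, Mc, Matrix.mul_apply, Fin.sum_univ_two]
lemma Mb_mul (M N : SLZ) : Mb (M * N) = Ma M * Mb N + Mb M * Md N := by
  simp [Ma, Mb, Md, Matrix.mul_apply, Fin.sum_univ_two]
lemma Mc_mul (M N : SLZ) : Mc (M * N) = Mc M * Ma N + Md M * Mc N := by
  simp [Ma, Mc, Md, Matrix.mul_apply, Fin.sum_univ_two]
lemma Md_mul (M N : SLZ) : Md (M * N) = Mc M * Mb N + Md M * Md N := by
  simp [Mb, Mc, Md, Matrix.mul_apply, Fin.sum_univ_two]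

lemma Ma_inv (M : SLZ) : Ma M⁻¹ = Md M := by
  simp [Ma, Md, Matrix.SpecialLinearGroup.SL2_inv_expl]
lemma Mb_inv (M : SLZ) : Mb M⁻¹ = -Mb M := by
  simp [Mb, Matrix.SpecialLinearGroup.SL2_inv_expl]
lemma Mc_inv (M : SLZ) : Mc M⁻¹ = -Mc M := by
  simp [Mc, Matrix.SpecialLinearGroup.SL2_inv_expl]
lemma Md_inv (M : SLZ) : Md M⁻¹ = Ma M := by
  simp [Ma, Md, Matrix.SpecialLinearGroup.SL2_inv_expl]

def PM (G : ℂ → ℂ → ℂ → ℂ) (M : SLZ) : Prop := ∀ τ u v : ℂ, UHP τ →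
  G ((Ma M * τ + Mb M) / (Mc M * τ + Md M)) (u / (Mc M * τ + Md M)) (v / (Mc M * τ + Md M)) =
    (Mc M * τ + Md M) ^ 4 * eC (2 * Mc M * (u ^ 2 + v ^ 2) / (Mc M * τ + Md M)) * G τ u v

lemma PM_mul {G : ℂ → ℂ → ℂ → ℂ} {M N : SLZ} (hM : PM G M) (hN : PM G N) : PM G (M * N) := by
  intro τ u v hτ
  have h1 := hN τ u v hτ
  have hj := mob_ne N hτ
  have hU := mob_UHP N hτ
  have hj' := mob_ne M hU
  have h2 := hM _ (u / (Mc N * τ + Md N)) (v / (Mc N * τ + Md N)) hU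
  rw [h1] at h2
  have hd := M_det N
  have hjj : Mc (M * N) * τ + Md (M * N) =
      (Mc M * ((Ma N * τ + Mb N) / (Mc N * τ + Md N)) + Md M) * (Mc N * τ + Md N) := by
    rw [Mc_mul, Md_mul]; field_simp; ring
  have hjn := mob_ne (M * N) hτ
  have e1 : (Ma (M * N) * τ + Mb (M * N)) / (Mc (M * N) * τ + Md (M * N)) =
      (Ma M * ((Ma N * τ + Mb N) / (Mc N * τ + Md N)) + Mb M) /
      (Mc M * ((Ma N * τ + Mb N) / (Mc N * τ + Md N)) + Md M) := by
    rw [div_eq_div_iff hjn hj', hjj, Ma_mul, Mb_mul]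
    generalize Mc M * ((Ma N * τ + Mb N) / (Mc N * τ + Md N)) + Md M = J
    field_simp; ring
  have e2 : ∀ w : ℂ, w / (Mc (M * N) * τ + Md (M * N)) = w / (Mc N * τ + Md N) /
      (Mc M * ((Ma N * τ + Mb N) / (Mc N * τ + Md N)) + Md M) := by
    intro w; rw [hjj, div_div, mul_comm]
  have hcj : Mc (M * N) * (Mc N * τ + Md N) = Mc M + Mc N * (Mc (M * N) * τ + Md (M * N)) := by
    rw [Mc_mul, Md_mul]; linear_combination (Mc M) * hd
  have e3 : 2 * Mc (M * N) * (u ^ 2 + v ^ 2) / (Mc (M * N) * τ + Md (M * N)) =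
      2 * Mc M * ((u / (Mc N * τ + Md N)) ^ 2 + (v / (Mc N * τ + Md N)) ^ 2) /
        (Mc M * ((Ma N * τ + Mb N) / (Mc N * τ + Md N)) + Md M) +
      2 * Mc N * (u ^ 2 + v ^ 2) / (Mc N * τ + Md N) := by
    have hc : Mc (M * N) = (Mc M + Mc N * (Mc (M * N) * τ + Md (M * N))) / (Mc N * τ + Md N) := by
      rw [← hcj]; field_simp
    generalize hA : Mc (M * N) * τ + Md (M * N) = A at *
    rw [hc]
    rw [hjj] at hjn ⊢
    generalize Mc M * ((Ma N * τ + Mb N) / (Mc N * τ + Md N)) + Md M = J at *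
    generalize Mc N * τ + Md N = j at *
    field_simp
  rw [e1, e2 u, e2 v, h2, e3, eC_add, hjj]; ring

lemma PM_all {G : ℂ → ℂ → ℂ → ℂ} (hT : ∀ τ u v, UHP τ → G (τ + 1) u v = G τ u v)
    (hS : ∀ τ u v, UHP τ → G (-1 / τ) (u / τ) (v / τ) = τ ^ 4 * eC (2 * (u ^ 2 + v ^ 2) / τ) * G τ u v)
    (hR : ∀ τ u v, UHP τ → G τ v (-u) = G τ u v) (M : SLZ) : PM G M := by
  have hn : ∀ τ u v, UHP τ → G τ (-u) (-v) = G τ u v := fun τ u v h => by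
    rw [hR τ v (-u) h, hR τ u v h]
  have iS : PM G ModularGroup.S := by
    intro τ u v hτ
    simpa [Ma, Mb, Mc, Md, ModularGroup.S] using hS τ u v hτ
  have iT : PM G ModularGroup.T := by
    intro τ u v hτ
    simpa [Ma, Mb, Mc, Md, ModularGroup.T, eC_zero] using hT τ u v hτ
  have iT' : PM G ModularGroup.T⁻¹ := by
    intro τ u v hτ
    have := hT (τ - 1) u v (by simpa [UHP] using hτ)
    simp only [sub_add_cancel] at this
    rw [Ma_inv, Mb_inv, Mc_inv, Md_inv]
    simp [Ma, Mb, Mc, Md, ModularGroup.T, eC_zero, this, ← sub_eq_add_neg]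
  have iS' : PM G ModularGroup.S⁻¹ := by
    intro τ u v hτ
    have := hS τ u v hτ
    have h2 := hn (-1 / τ) (u / τ) (v / τ) (by
      have := mob_UHP ModularGroup.S hτ
      simpa [Ma, Mb, Mc, Md, ModularGroup.S] using this)
    rw [this] at h2
    rw [Ma_inv, Mb_inv, Mc_inv, Md_inv]
    have ea : Ma ModularGroup.S = 0 := by simp [Ma, ModularGroup.S]
    have eb : Mb ModularGroup.S = -1 := by simp [Mb, ModularGroup.S]
    have ec : Mc ModularGroup.S = 1 := by simp [Mc, ModularGroup.S]
    have ed : Md ModularGroup.S = 0 := by simp [Md, ModularGroup.S]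
    rw [ea, eb, ec, ed]
    have f1 : ((0 : ℂ) * τ + - -1) / (-1 * τ + 0) = -1 / τ := by
      rw [show (-1 * τ + 0 : ℂ) = -τ by ring, div_neg]; ring
    have f2 : ∀ w : ℂ, w / (-1 * τ + 0) = -(w / τ) := fun w => by
      rw [show (-1 * τ + 0 : ℂ) = -τ by ring, div_neg]
    rw [f1, f2, f2, h2, f2]
    congr 2
    · ring
    · congr 1; ring
  have hM : M ∈ Subgroup.closure ({ModularGroup.S, ModularGroup.T} : Set SLZ) := by
    rw [SpecialLinearGroup.SL2Z_generators]; trivial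
  induction hM using Subgroup.closure_induction_left with
  | one => intro τ u v hτ; simp [Ma, Mb, Mc, Md, eC_zero]
  | mul_left x hx y hy ih =>
    rcases hx with rfl | rfl
    · exact PM_mul iS ih
    · exact PM_mul iT ih
  | inv_mul_cancel x hx y hy ih =>
    rcases hx with rfl | rfl
    · exact PM_mul iS' ih
    · exact PM_mul iT' ih

lemma mkHJF {φ G : ℂ → ℂ → ℂ → ℂ}
    (hφ : ∀ τ z₁ z₂, UHP τ → φ τ z₁ z₂ = G τ ((z₁ + z₂) / 2) (I * (z₁ - z₂) / 2))
    (hd : ∀ p : ℂ × ℂ × ℂ, UHP p.1 → DifferentiableAt ℂ (fun p : ℂ × ℂ × ℂ => G p.1 p.2.1 p.2.2) p)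
    (hT : ∀ τ u v, UHP τ → G (τ + 1) u v = G τ u v)
    (hS : ∀ τ u v, UHP τ → G (-1 / τ) (u / τ) (v / τ) = τ ^ 4 * eC (2 * (u ^ 2 + v ^ 2) / τ) * G τ u v)
    (hR : ∀ τ u v, UHP τ → G τ v (-u) = G τ u v)
    (hE : ∀ (p s q t : ℤ) τ u v, UHP τ → G τ (u + p * τ + s) (v + q * τ + t) =
      eC (-2 * ((p ^ 2 + q ^ 2) * τ + 2 * p * u + 2 * q * v)) * G τ u v)
    (hF : RepP QQ G) : IsHJF 4 2 φ := by
  refine ⟨?_, ?_, ?_, ?_⟩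
  · intro p hp
    have h1 : DifferentiableAt ℂ (fun p : ℂ × ℂ × ℂ => G p.1 ((p.2.1 + p.2.2) / 2)
        (I * (p.2.1 - p.2.2) / 2)) p := by
      have := hd (p.1, (p.2.1 + p.2.2) / 2, I * (p.2.1 - p.2.2) / 2) hp
      exact DifferentiableAt.comp
        (f := fun p : ℂ × ℂ × ℂ => (p.1, (p.2.1 + p.2.2) / 2, I * (p.2.1 - p.2.2) / 2)) p this
        (by fun_prop)
    exact h1.differentiableWithinAt.congr (fun q hq => hφ _ _ _ hq) (hφ _ _ _ hp)
  · intro ε hε M τ z₁ z₂ hτ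
    have hU := mob_UHP M hτ
    have key : ε ^ 4 = 1 ∧ ∀ τ' : ℂ, UHP τ' →
        G τ' ((ε * z₁ / (Mc M * τ + Md M) + (starRingEnd ℂ) ε * z₂ / (Mc M * τ + Md M)) / 2)
         (I * (ε * z₁ / (Mc M * τ + Md M) - (starRingEnd ℂ) ε * z₂ / (Mc M * τ + Md M)) / 2) =
        G τ' ((z₁ + z₂) / 2 / (Mc M * τ + Md M)) (I * (z₁ - z₂) / 2 / (Mc M * τ + Md M)) := by
      generalize Mc M * τ + Md M = J
      have hI : I * I = -1 := I_mul_I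
      have hn : ∀ τ u v, UHP τ → G τ (-u) (-v) = G τ u v := fun τ u v h => by
        rw [hR τ v (-u) h, hR τ u v h]
      rcases hε with rfl | rfl | rfl | rfl
      · refine ⟨by norm_num, fun τ' h' => ?_⟩
        congr 1 <;> simp <;> ring
      · refine ⟨by norm_num, fun τ' h' => ?_⟩
        rw [← hn _ _ _ h']
        congr 1 <;> simp <;> ring
      · refine ⟨I_pow_four, fun τ' h' => ?_⟩
        rw [← hR τ' ((z₁ + z₂) / 2 / J) (I * (z₁ - z₂) / 2 / J) h']
        congr 1
        · simp; ring
        · simp; linear_combination (z₁ / J / 2 + z₂ / J / 2) * hI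
      · refine ⟨by rw [neg_pow, I_pow_four]; norm_num, fun τ' h' => ?_⟩
        rw [← hR τ' ((z₁ + z₂) / 2 / J) (I * (z₁ - z₂) / 2 / J) h', ← hn τ' (I * (z₁ - z₂) / 2 / J) _ h']
        congr 1
        · simp; ring
        · simp; linear_combination (-(z₁ / J / 2) - z₂ / J / 2) * hI
    rw [hφ _ _ _ hU, hφ _ _ _ hτ, key.2 _ hU, PM_all hT hS hR M _ _ _ hτ, key.1, one_mul]
    congr 3
    push_cast
    congr 1
    linear_combination (Mc M * (z₁ - z₂) ^ 2 / 2) * I_sq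
  · intro p q s t τ z₁ z₂ hτ
    rw [hφ _ _ _ hτ, hφ _ _ _ hτ]
    have := hE p s (-q) (-t) τ ((z₁ + z₂) / 2) (I * (z₁ - z₂) / 2) hτ
    convert this using 2
    · ring
    · push_cast; linear_combination (q * τ + t) * I_sq
    · push_cast; congr 1; ring
  · obtain ⟨c, h0, hs⟩ := rep_fourier hF hT
    refine ⟨c, fun n a b h => h0 n a b (by push_cast at h; linarith), fun τ z₁ z₂ hτ => ?_⟩
    rw [hφ _ _ _ hτ]
    refine (hs τ _ _ hτ).congr_fun fun p => ?_
    congr 2; ring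

lemma zeta4 : eC (1 / 8) ^ 4 = -1 := by
  rw [← eC_nat_mul, ← eC_half]; congr 1; norm_num

lemma sqf8 (τ : ℂ) : sqf τ ^ 8 = τ ^ 4 := by
  have := @sqf_sq τ
  have h4 := I_pow_four
  calc sqf τ ^ 8 = (sqf τ ^ 2) ^ 4 := by ring
    _ = I ^ 4 * τ ^ 4 := by rw [this]; ring
    _ = τ ^ 4 := by rw [h4, one_mul]

lemma eC_uv (u v τ : ℂ) : eC (2 * (u ^ 2 + v ^ 2) / τ) = eC (2 * u ^ 2 / τ) * eC (2 * v ^ 2 / τ) := by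
  rw [← eC_add]; congr 1; ring

lemma eC_ell (p q : ℤ) (τ u v : ℂ) : eC (-2 * ((p ^ 2 + q ^ 2) * τ + 2 * p * u + 2 * q * v)) =
    eC (-2 * (p ^ 2 * τ + 2 * p * u)) * eC (-2 * (q ^ 2 * τ + 2 * q * v)) := by
  rw [← eC_add]; congr 1; ring

lemma hjf1 : IsHJF 4 2 Phi42 := by
  refine mkHJF (G := G1) (fun τ z₁ z₂ h => Phi42_eq h z₁ z₂) ?_ ?_ ?_ ?_ ?_ rep_G1
  · intro p hp
    have hx := diff_TX (f := fun p : ℂ × ℂ × ℂ => p.1) (g := fun _ => 0) (p := p) (by fun_prop) (by fun_prop) hp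
    have hy := diff_TY (f := fun p : ℂ × ℂ × ℂ => p.1) (g := fun _ => 0) (p := p) (by fun_prop) (by fun_prop) hp
    have hz := diff_TZ (f := fun p : ℂ × ℂ × ℂ => p.1) (g := fun _ => 0) (p := p) (by fun_prop) (by fun_prop) hp
    have hxu := diff_TX (f := fun p : ℂ × ℂ × ℂ => p.1) (g := fun p => p.2.1) (p := p) (by fun_prop) (by fun_prop) hp
    have hyu := diff_TY (f := fun p : ℂ × ℂ × ℂ => p.1) (g := fun p => p.2.1) (p := p) (by fun_prop) (by fun_prop) hp
    have hzu := diff_TZ (f := fun p : ℂ × ℂ × ℂ => p.1) (g := fun p => p.2.1) (p := p) (by fun_prop) (by fun_prop) hp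
    have hxv := diff_TX (f := fun p : ℂ × ℂ × ℂ => p.1) (g := fun p => p.2.2) (p := p) (by fun_prop) (by fun_prop) hp
    have hyv := diff_TY (f := fun p : ℂ × ℂ × ℂ => p.1) (g := fun p => p.2.2) (p := p) (by fun_prop) (by fun_prop) hp
    have hzv := diff_TZ (f := fun p : ℂ × ℂ × ℂ => p.1) (g := fun p => p.2.2) (p := p) (by fun_prop) (by fun_prop) hp
    exact (((hx.pow 6).mul (hxu.mul hxv)).add ((hy.pow 6).mul (hyu.mul hyv))).add
      ((hz.pow 6).mul (hzu.mul hzv))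
  · intro τ u v h
    simp only [G1, TX_T, TY_T, TZ_T]
    linear_combination (TZ τ 0 ^ 6 * TZ τ u * TZ τ v) * (eC (1 / 8) ^ 4 - 1) * zeta4
  · intro τ u v h
    simp only [G1, TX_S0 h, TY_S0 h, TZ_S0 h, TX_S h, TY_S h, TZ_S h, eC_uv, ← sqf8]
    ring
  · intro τ u v h
    simp only [G1, TX_neg, TY_neg, TZ_neg h]; ring
  · intro p s q t τ u v h
    simp only [G1, TX_ell _ _ h, TY_ell _ _ h, TZ_ell _ _ h, eC_ell]; ring

lemma hjf2 : IsHJF 4 2 PhiTilde42 := by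
  refine mkHJF (G := G2) (fun τ z₁ z₂ h => PhiTilde42_eq h z₁ z₂) ?_ ?_ ?_ ?_ ?_ rep_G2
  · intro p hp
    have hx := diff_TX (f := fun p : ℂ × ℂ × ℂ => p.1) (g := fun _ => 0) (p := p) (by fun_prop) (by fun_prop) hp
    have hy := diff_TY (f := fun p : ℂ × ℂ × ℂ => p.1) (g := fun _ => 0) (p := p) (by fun_prop) (by fun_prop) hp
    have hz := diff_TZ (f := fun p : ℂ × ℂ × ℂ => p.1) (g := fun _ => 0) (p := p) (by fun_prop) (by fun_prop) hp
    have hxu := diff_TX (f := fun p : ℂ × ℂ × ℂ => p.1) (g := fun p => p.2.1) (p := p) (by fun_prop) (by fun_prop) hp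
    have hyu := diff_TY (f := fun p : ℂ × ℂ × ℂ => p.1) (g := fun p => p.2.1) (p := p) (by fun_prop) (by fun_prop) hp
    have hzu := diff_TZ (f := fun p : ℂ × ℂ × ℂ => p.1) (g := fun p => p.2.1) (p := p) (by fun_prop) (by fun_prop) hp
    have hxv := diff_TX (f := fun p : ℂ × ℂ × ℂ => p.1) (g := fun p => p.2.2) (p := p) (by fun_prop) (by fun_prop) hp
    have hyv := diff_TY (f := fun p : ℂ × ℂ × ℂ => p.1) (g := fun p => p.2.2) (p := p) (by fun_prop) (by fun_prop) hp
    have hzv := diff_TZ (f := fun p : ℂ × ℂ × ℂ => p.1) (g := fun p => p.2.2) (p := p) (by fun_prop) (by fun_prop) hp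
    exact (((((hx.pow 3).mul (hy.pow 3)).mul ((hxu.mul hyv).add (hyu.mul hxv))).add
      (((hx.pow 3).mul (hz.pow 3)).mul ((hxu.mul hzv).add (hzu.mul hxv)))).sub
      (((hy.pow 3).mul (hz.pow 3)).mul ((hyu.mul hzv).add (hzu.mul hyv))))
  · intro τ u v h
    simp only [G2, TX_T, TY_T, TZ_T]
    linear_combination (TY τ 0 ^ 3 * TZ τ 0 ^ 3 * (TY τ u * TZ τ v + TZ τ u * TY τ v) -
      TX τ 0 ^ 3 * TZ τ 0 ^ 3 * (TX τ u * TZ τ v + TZ τ u * TX τ v)) * zeta4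
  · intro τ u v h
    simp only [G2, TX_S0 h, TY_S0 h, TZ_S0 h, TX_S h, TY_S h, TZ_S h, eC_uv, ← sqf8]
    ring
  · intro τ u v h
    simp only [G2, TX_neg, TY_neg, TZ_neg h]; ring
  · intro p s q t τ u v h
    simp only [G2, TX_ell _ _ h, TY_ell _ _ h, TZ_ell _ _ h, eC_ell]; ring


lemma uhp_open : IsOpen {τ : ℂ | UHP τ} := by
  unfold UHP
  exact isOpen_lt continuous_const Complex.continuous_im

lemma lemG_bound {ι : Type} {c : ι → ℂ} {N : ι → ℝ} {N0 : ℝ}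
    (hs : ∀ τ, UHP τ → Summable fun i => c i * eC ((N i : ℂ) * τ))
    (hN : ∀ i, c i ≠ 0 → N0 ≤ N i) :
    ∃ A : ℝ, 0 ≤ A ∧ ∀ τ : ℂ, 1 ≤ τ.im → ‖∑' i, c i * eC ((N i : ℂ) * τ)‖ ≤ A * ‖eC ((N0 : ℂ) * τ)‖ := by
  have h1 := (hs I (by simp [UHP])).norm
  refine ⟨(∑' i, ‖c i * eC ((N i : ℂ) * I)‖) * Real.exp (2 * Real.pi * N0), by positivity, fun τ hτ => ?_⟩
  have hb : ∀ i, ‖c i * eC ((N i : ℂ) * τ)‖ ≤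
      ‖c i * eC ((N i : ℂ) * I)‖ * (Real.exp (2 * Real.pi * N0) * ‖eC ((N0 : ℂ) * τ)‖) := by
    intro i
    by_cases hc : c i = 0
    · simp [hc]
    have := hN i hc
    rw [norm_mul, norm_mul, norm_eC, norm_eC, norm_eC, mul_assoc ‖c i‖, ← Real.exp_add, ← Real.exp_add]
    gcongr
    simp only [im_ofReal_mul, I_im]
    have hp := Real.pi_pos
    nlinarith [mul_nonneg (mul_nonneg hp.le (sub_nonneg.2 this)) (sub_nonneg.2 hτ)]
  have h2 := h1.mul_right (Real.exp (2 * Real.pi * N0) * ‖eC ((N0 : ℂ) * τ)‖)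
  have h3 := tsum_of_norm_bounded h2.hasSum hb
  rw [tsum_mul_right] at h3
  rwa [mul_assoc]

lemma lemG_holo {ι : Type} {c : ι → ℂ} {N : ι → ℝ}
    (hs : ∀ τ, UHP τ → Summable fun i => c i * eC ((N i : ℂ) * τ))
    (hN : ∀ i, c i ≠ 0 → 0 ≤ N i) :
    DifferentiableOn ℂ (fun τ => ∑' i, c i * eC ((N i : ℂ) * τ)) {τ | UHP τ} := by
  intro τ hτ
  have hτ' : 0 < τ.im := hτ
  have hopen : IsOpen {w : ℂ | τ.im / 2 < w.im} := isOpen_lt continuous_const Complex.continuous_im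
  have hU : UHP ((τ.im / 2 : ℝ) * I) := by simp [UHP]; linarith
  have h1 := (hs _ hU).norm
  have hd : DifferentiableOn ℂ (fun τ => ∑' i, c i * eC ((N i : ℂ) * τ)) {w : ℂ | τ.im / 2 < w.im} := by
    refine differentiableOn_tsum_of_summable_norm h1 (fun i => ?_) hopen fun i w hw => ?_
    · unfold eC; fun_prop
    · by_cases hc : c i = 0
      · simp [hc]
      have := hN i hc
      rw [norm_mul, norm_mul, norm_eC, norm_eC]
      refine mul_le_mul_of_nonneg_left (Real.exp_le_exp.2 ?_) (norm_nonneg _)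
      simp only [im_ofReal_mul, I_im, mul_one, ofReal_im, mul_im, ofReal_re, I_re]
      have hp := Real.pi_pos
      have hw' : τ.im / 2 < w.im := hw
      nlinarith [mul_nonneg (mul_nonneg hp.le this) (sub_nonneg.2 hw'.le)]
  exact ((hd τ (by simp; linarith)).differentiableAt (hopen.mem_nhds (by simp; linarith))).differentiableWithinAt

open UpperHalfPlane ModularForm in
lemma W0 {f : ℂ → ℂ} (hd : DifferentiableOn ℂ f {τ | UHP τ})
    (hT : ∀ τ, UHP τ → f (τ + 1) = f τ) (hS : ∀ τ, UHP τ → f (-1 / τ) = f τ)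
    (hb : ∃ A B : ℝ, ∀ τ : ℂ, UHP τ → B ≤ τ.im → ‖f τ‖ ≤ A) : ∃ C, ∀ τ, UHP τ → f τ = C := by
  have iS : (fun z : ℍ => f z) ∣[(0 : ℤ)] ModularGroup.S = fun z : ℍ => f z := by
    ext z
    rw [ModularForm.SL_slash_apply, UpperHalfPlane.modular_S_smul]
    have := hS z z.im_pos
    simpa [neg_div] using this
  have iT : (fun z : ℍ => f z) ∣[(0 : ℤ)] ModularGroup.T = fun z : ℍ => f z := by
    ext z
    rw [ModularForm.SL_slash_apply, UpperHalfPlane.modular_T_smul]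
    have := hT z z.im_pos
    simpa [add_comm] using this
  let F : ModularForm (Matrix.SpecialLinearGroup.mapGL ℝ : Matrix.SpecialLinearGroup (Fin 2) ℤ →* _).range 0 :=
    { toFun := fun z : ℍ => f z
      slash_action_eq' := by
        rintro A ⟨A, rfl⟩
        exact SlashInvariantForm.slash_action_generators_SL2Z iS iT A
      holo' := by
        rw [UpperHalfPlane.mdifferentiable_iff]
        refine DifferentiableOn.congr (f := f) hd fun z hz => ?_
        simp [ofComplex_apply_of_im_pos hz]
      bdd_at_cusps' := by
        intro c hc
        rw [Subgroup.IsArithmetic.isCusp_iff_isCusp_SL2Z] at hc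
        rw [OnePoint.isBoundedAt_iff_forall_SL2Z hc]
        intro γ _
        rw [SlashInvariantForm.slash_action_generators_SL2Z iS iT]
        rw [UpperHalfPlane.isBoundedAtImInfty_iff]
        obtain ⟨A, B, h⟩ := hb
        exact ⟨A, B, fun z hz => h z z.im_pos hz⟩ }
  obtain ⟨C, hC⟩ := ModularFormClass.levelOne_weight_zero_const F
  exact ⟨C, fun τ hτ => congrFun hC ⟨τ, hτ⟩⟩


lemma bd_X : ∃ A : ℝ, 0 ≤ A ∧ ∀ τ : ℂ, 1 ≤ τ.im → ‖TX τ 0‖ ≤ A := by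
  have key : ∀ τ, UHP τ → HasSum (fun n : ℤ => (1 : ℂ) * eC ((((n : ℝ) ^ 2 / 2 : ℝ) : ℂ) * τ)) (TX τ 0) := by
    intro τ hτ
    refine (hasSum_TX hτ 0).congr_fun fun n => ?_
    push_cast; rw [one_mul]; congr 1; ring
  obtain ⟨A, hA, h⟩ := lemG_bound (N0 := 0) (fun τ hτ => (key τ hτ).summable) (fun i _ => by positivity)
  refine ⟨A, hA, fun τ hτ => ?_⟩
  have := h τ hτ
  rw [(key τ (by unfold UHP; linarith)).tsum_eq] at this
  simpa [eC_zero] using this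

lemma bd_Y : ∃ A : ℝ, 0 ≤ A ∧ ∀ τ : ℂ, 1 ≤ τ.im → ‖TY τ 0‖ ≤ A := by
  obtain ⟨A, hA, h⟩ := bd_X
  refine ⟨A, hA, fun τ hτ => ?_⟩
  rw [← TX_T]
  exact h _ (by simpa using hτ)

lemma bd_Z : ∃ A : ℝ, 0 ≤ A ∧ ∀ τ : ℂ, 1 ≤ τ.im → ‖TZ τ 0‖ ≤ A * ‖eC (1 / 8 * τ)‖ := by
  have key : ∀ τ, UHP τ → HasSum (fun n : ℤ => (1 : ℂ) * eC (((((n : ℝ) + 1 / 2) ^ 2 / 2 : ℝ) : ℂ) * τ)) (TZ τ 0) := by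
    intro τ hτ
    refine (hasSum_TZ hτ 0).congr_fun fun n => ?_
    push_cast; rw [one_mul]; congr 1; ring
  obtain ⟨A, hA, h⟩ := lemG_bound (N0 := 1 / 8) (fun τ hτ => (key τ hτ).summable) (fun n _ => by
    have : (0 : ℝ) ≤ (n : ℝ) * (n + 1) := by
      have : (0 : ℤ) ≤ n * (n + 1) := by
        rcases le_or_gt 0 n with h | h
        · positivity
        · nlinarith
      exact_mod_cast this
    nlinarith)
  refine ⟨A, hA, fun τ hτ => ?_⟩
  have := h τ hτ
  rw [(key τ (by unfold UHP; linarith)).tsum_eq] at this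
  simpa using this

def Dl (τ : ℂ) : ℂ := ModularForm.eta τ ^ 24

lemma Dl_ne {τ : ℂ} (h : UHP τ) : Dl τ ≠ 0 := pow_ne_zero _ (ModularForm.eta_ne_zero h)

lemma Dl_diff : DifferentiableOn ℂ Dl {τ | UHP τ} := fun _ hz =>
  ((ModularForm.differentiableAt_eta_of_mem_upperHalfPlaneSet hz).pow 24).differentiableWithinAt

lemma Dl_T {τ : ℂ} (h : UHP τ) : Dl (τ + 1) = Dl τ := by
  have := congrFun ModularForm.discriminant_T_invariant ⟨τ, h⟩
  rw [ModularForm.SL_slash_apply, UpperHalfPlane.modular_T_smul] at this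
  have e0 : ModularGroup.T 1 0 = 0 := by simp [ModularGroup.T]
  have e1 : ModularGroup.T 1 1 = 1 := by simp [ModularGroup.T]
  simp [ModularForm.discriminant, UpperHalfPlane.denom, e0, e1] at this
  unfold Dl
  rw [← this, add_comm]

lemma Dl_S {τ : ℂ} (h : UHP τ) : Dl (-1 / τ) = τ ^ 12 * Dl τ := by
  have := congrFun ModularForm.discriminant_S_invariant ⟨τ, h⟩
  rw [ModularForm.SL_slash_apply, UpperHalfPlane.modular_S_smul] at this
  have e0 : ModularGroup.S 1 0 = 1 := by simp [ModularGroup.S]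
  have e1 : ModularGroup.S 1 1 = 0 := by simp [ModularGroup.S]
  simp [ModularForm.discriminant, UpperHalfPlane.denom, e0, e1] at this
  unfold Dl
  rw [← this]
  have h0 := h.ne
  rw [neg_div, one_div]
  field_simp [zpow_neg]

lemma Dl_lb : ∃ A B : ℝ, 0 ≤ A ∧ 1 ≤ B ∧ ∀ τ : ℂ, B ≤ τ.im → ‖eC τ‖ ≤ A * ‖Dl τ‖ := by
  obtain ⟨A, hA, h⟩ := ModularForm.exp_isBigO_discriminant.exists_nonneg
  have h := h.bound
  rw [Filter.Eventually, UpperHalfPlane.atImInfty_mem] at h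
  obtain ⟨B, hB⟩ := h
  refine ⟨A, max B 1, hA, le_max_right _ _, fun τ hτ => ?_⟩
  have hU : UHP τ := by
    have := le_trans (le_max_right B 1) hτ
    unfold UHP; linarith
  have := hB ⟨τ, hU⟩ (le_trans (le_max_left B 1) hτ)
  simp only [Set.mem_ofPred_eq, Real.norm_eq_abs, Real.abs_exp] at this
  rw [norm_eC]
  exact this

lemma dX : DifferentiableOn ℂ (fun τ => TX τ 0) {τ | UHP τ} := fun τ h =>
  (diff_TX (f := fun τ : ℂ => τ) (g := fun _ => 0) (by fun_prop) (by fun_prop) h).differentiableWithinAt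
lemma dY : DifferentiableOn ℂ (fun τ => TY τ 0) {τ | UHP τ} := fun τ h =>
  (diff_TY (f := fun τ : ℂ => τ) (g := fun _ => 0) (by fun_prop) (by fun_prop) h).differentiableWithinAt
lemma dZ : DifferentiableOn ℂ (fun τ => TZ τ 0) {τ | UHP τ} := fun τ h =>
  (diff_TZ (f := fun τ : ℂ => τ) (g := fun _ => 0) (by fun_prop) (by fun_prop) h).differentiableWithinAt

lemma ne_of_possum {f : ℤ → ℂ} {a : ℂ} (h : HasSum f a) (hp : ∀ n, ∃ r : ℝ, 0 < r ∧ f n = r) : a ≠ 0 := by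
  choose r hr hf using hp
  have h1 := Complex.hasSum_re h
  have h2 : HasSum r a.re := h1.congr_fun fun n => by rw [hf]; simp
  have h3 : 0 < a.re := by
    rw [← h2.tsum_eq]
    exact h2.summable.tsum_pos (fun n => (hr n).le) 0 (hr 0)
  intro h0
  rw [h0] at h3
  simp at h3

lemma UI : UHP I := by simp [UHP]

lemma XI : TX I 0 ≠ 0 := by
  refine ne_of_possum (hasSum_TX UI 0) fun n => ⟨Real.exp (-Real.pi * n ^ 2), Real.exp_pos _, ?_⟩
  rw [eC, ofReal_exp]; congr 1; push_cast; linear_combination (Real.pi * n ^ 2 : ℂ) * I_sq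

lemma ZI : TZ I 0 ≠ 0 := by
  refine ne_of_possum (hasSum_TZ UI 0) fun n => ⟨Real.exp (-Real.pi * (n + 1 / 2) ^ 2), Real.exp_pos _, ?_⟩
  rw [eC, ofReal_exp]; congr 1; push_cast; linear_combination (Real.pi * (n + 1 / 2) ^ 2 : ℂ) * I_sq

lemma YI : TY I 0 ≠ 0 := by
  have := TY_S0 UI
  rw [show -1 / I = I by rw [div_eq_iff I_ne_zero, I_mul_I]] at this
  rw [this]
  exact mul_ne_zero (sqf_ne UI) ZI

lemma zeta8 : eC (1 / 8) ^ 8 = 1 := by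
  linear_combination (eC (1 / 8) ^ 4 - 1) * zeta4

lemma xyz_Dl : ∃ C : ℂ, C ≠ 0 ∧ ∀ τ, UHP τ → (TX τ 0 * TY τ 0 * TZ τ 0) ^ 8 = C * Dl τ := by
  obtain ⟨C, hC⟩ := W0 (f := fun τ => (TX τ 0 * TY τ 0 * TZ τ 0) ^ 8 / Dl τ)
    ((((dX.mul dY).mul dZ).pow 8).div Dl_diff fun τ h => Dl_ne h)
    (fun τ h => by
      simp only [TX_T, TY_T, TZ_T, Dl_T h]
      congr 1
      linear_combination ((TX τ 0 * TY τ 0 * TZ τ 0) ^ 8) * zeta8)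
    (fun τ h => by
      simp only [TX_S0 h, TY_S0 h, TZ_S0 h, Dl_S h]
      rw [show (sqf τ * TX τ 0 * (sqf τ * TZ τ 0) * (sqf τ * TY τ 0)) ^ 8 =
        (sqf τ ^ 8) ^ 3 * (TX τ 0 * TY τ 0 * TZ τ 0) ^ 8 by ring, sqf8,
        show (τ ^ 4) ^ 3 = τ ^ 12 by ring]
      exact mul_div_mul_left _ _ (pow_ne_zero _ h.ne))
    (by
      obtain ⟨A, hA, hX⟩ := bd_X
      obtain ⟨A', hA', hY⟩ := bd_Y
      obtain ⟨A'', hA'', hZ⟩ := bd_Z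
      obtain ⟨K, B, hK, hB, hD⟩ := Dl_lb
      refine ⟨(A * A' * A'') ^ 8 * K, B, fun τ hτ hb => ?_⟩
      have h1 : 1 ≤ τ.im := le_trans hB hb
      rw [norm_div, div_le_iff₀ (norm_pos_iff.2 (Dl_ne hτ)), norm_pow, norm_mul, norm_mul]
      calc (‖TX τ 0‖ * ‖TY τ 0‖ * ‖TZ τ 0‖) ^ 8
          ≤ (A * A' * (A'' * ‖eC (1 / 8 * τ)‖)) ^ 8 := by
            gcongr
            · exact hX τ h1
            · exact hY τ h1
            · exact hZ τ h1
        _ = (A * A' * A'') ^ 8 * ‖eC (1 / 8 * τ) ^ 8‖ := by rw [norm_pow]; ring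
        _ = (A * A' * A'') ^ 8 * ‖eC τ‖ := by
            rw [← eC_nat_mul]; congr 3; push_cast; ring
        _ ≤ (A * A' * A'') ^ 8 * (K * ‖Dl τ‖) := by
            gcongr; exact hD τ hb
        _ = _ := by ring)
  refine ⟨C, ?_, fun τ h => by rw [← hC τ h, div_mul_cancel₀ _ (Dl_ne h)]⟩
  rw [← hC I UI]
  exact div_ne_zero (pow_ne_zero _ (mul_ne_zero (mul_ne_zero XI YI) ZI)) (Dl_ne UI)

lemma xyz_ne {τ : ℂ} (h : UHP τ) : TX τ 0 * TY τ 0 * TZ τ 0 ≠ 0 := by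
  obtain ⟨C, h0, hC⟩ := xyz_Dl
  intro h1
  have := hC τ h
  rw [h1] at this
  exact mul_ne_zero h0 (Dl_ne h) (by rw [← this]; simp)

lemma X_ne {τ : ℂ} (h : UHP τ) : TX τ 0 ≠ 0 := left_ne_zero_of_mul (left_ne_zero_of_mul (xyz_ne h))
lemma Y_ne {τ : ℂ} (h : UHP τ) : TY τ 0 ≠ 0 := right_ne_zero_of_mul (left_ne_zero_of_mul (xyz_ne h))
lemma Z_ne {τ : ℂ} (h : UHP τ) : TZ τ 0 ≠ 0 := right_ne_zero_of_mul (xyz_ne h)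

/-- lower bounds near infinity -/
lemma lb_all : ∃ A B : ℝ, 0 ≤ A ∧ 1 ≤ B ∧ ∀ τ : ℂ, B ≤ τ.im →
    1 ≤ A * ‖TX τ 0‖ ^ 8 ∧ 1 ≤ A * ‖TY τ 0‖ ^ 8 ∧ ‖eC (1 / 8 * τ)‖ ^ 8 ≤ A * ‖TZ τ 0‖ ^ 8 := by
  obtain ⟨C, hC0, hC⟩ := xyz_Dl
  obtain ⟨a, ha, hX⟩ := bd_X
  obtain ⟨a', ha', hY⟩ := bd_Y
  obtain ⟨a'', ha'', hZ⟩ := bd_Z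
  obtain ⟨K, B, hK, hB, hD⟩ := Dl_lb
  set L := K / ‖C‖ with hL
  have hL0 : 0 ≤ L := by positivity
  have hCp : 0 < ‖C‖ := norm_pos_iff.2 hC0
  have key : ∀ τ : ℂ, B ≤ τ.im → ‖eC (1 / 8 * τ)‖ ^ 8 ≤ L * (‖TX τ 0‖ * ‖TY τ 0‖ * ‖TZ τ 0‖) ^ 8 := by
    intro τ hb
    have h1 : 1 ≤ τ.im := le_trans hB hb
    have hU : UHP τ := by unfold UHP; linarith
    have h2 : ‖eC (1 / 8 * τ)‖ ^ 8 = ‖eC τ‖ := by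
      rw [← norm_pow, ← eC_nat_mul]; congr 2; push_cast; ring
    have h3 := congrArg norm (hC τ hU)
    rw [norm_pow, norm_mul, norm_mul, norm_mul] at h3
    rw [h2, h3, hL, div_mul_eq_mul_div, mul_comm ‖C‖, ← mul_assoc, mul_div_cancel_right₀ _ hCp.ne']
    exact hD τ hb
  refine ⟨L * (a' * a'') ^ 8 + L * (a * a'') ^ 8 + L * (a * a') ^ 8, B, by positivity, hB, fun τ hb => ?_⟩
  have h1 : 1 ≤ τ.im := le_trans hB hb
  have hk := key τ hb
  have hx := hX τ h1
  have hy := hY τ h1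
  have hz := hZ τ h1
  have he : 0 < ‖eC (1 / 8 * τ)‖ := norm_pos_iff.2 (eC_ne _)
  set e := ‖eC (1 / 8 * τ)‖
  set x := ‖TX τ 0‖
  set y := ‖TY τ 0‖
  set z := ‖TZ τ 0‖
  have hx0 : 0 ≤ x := norm_nonneg _
  have hy0 : 0 ≤ y := norm_nonneg _
  have hz0 : 0 ≤ z := norm_nonneg _
  refine ⟨?_, ?_, ?_⟩
  · have : e ^ 8 * 1 ≤ e ^ 8 * (L * (a' * a'') ^ 8 * x ^ 8) := by
      calc e ^ 8 * 1 ≤ L * (x * y * z) ^ 8 := by rwa [mul_one]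
        _ ≤ L * (x * a' * (a'' * e)) ^ 8 := by gcongr
        _ = _ := by ring
    have := le_of_mul_le_mul_left this (by positivity)
    refine this.trans ?_
    gcongr
    rw [add_assoc]
    exact le_add_of_nonneg_right (by positivity)
  · have : e ^ 8 * 1 ≤ e ^ 8 * (L * (a * a'') ^ 8 * y ^ 8) := by
      calc e ^ 8 * 1 ≤ L * (x * y * z) ^ 8 := by rwa [mul_one]
        _ ≤ L * (a * y * (a'' * e)) ^ 8 := by gcongr
        _ = _ := by ring
    have := le_of_mul_le_mul_left this (by positivity)
    refine this.trans ?_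
    gcongr
    rw [add_right_comm]
    exact le_add_of_nonneg_left (by positivity)
  · have : e ^ 8 ≤ L * (a * a') ^ 8 * z ^ 8 := by
      calc e ^ 8 ≤ L * (x * y * z) ^ 8 := hk
        _ ≤ L * (a * a' * z) ^ 8 := by gcongr
        _ = _ := by ring
    refine this.trans ?_
    gcongr
    exact le_add_of_nonneg_left (by positivity)

/-- inverse bounds -/
lemma inv_bd : ∃ A B : ℝ, 0 ≤ A ∧ 1 ≤ B ∧ ∀ τ : ℂ, B ≤ τ.im →
    ‖(TX τ 0)⁻¹‖ ≤ A ∧ ‖(TY τ 0)⁻¹‖ ≤ A ∧ ‖eC (1 / 8 * τ)‖ * ‖(TZ τ 0)⁻¹‖ ≤ A := by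
  obtain ⟨A, B, hA, hB, h⟩ := lb_all
  have aux : ∀ e x : ℝ, 0 ≤ e → 0 < x → e ^ 8 ≤ A * x ^ 8 → e * x⁻¹ ≤ A + 1 := by
    intro e x he hx h
    have h1 : (e * x⁻¹) ^ 8 ≤ A := by
      rw [mul_pow, inv_pow, ← div_eq_mul_inv, div_le_iff₀ (by positivity)]; exact h
    have h2 : A ≤ (A + 1) ^ 8 := by
      calc A ≤ A + 1 := by linarith
        _ ≤ (A + 1) ^ 8 := le_self_pow₀ (by linarith) (by norm_num)
    exact le_of_pow_le_pow_left₀ (by norm_num) (by linarith) (h1.trans h2)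
  refine ⟨A + 1, B, by linarith, hB, fun τ hb => ?_⟩
  have hU : UHP τ := by unfold UHP; linarith
  obtain ⟨h1, h2, h3⟩ := h τ hb
  simp only [norm_inv]
  refine ⟨?_, ?_, aux _ _ (norm_nonneg _) (norm_pos_iff.2 (Z_ne hU)) h3⟩
  · simpa using aux 1 _ zero_le_one (norm_pos_iff.2 (X_ne hU)) (by simpa using h1)
  · simpa using aux 1 _ zero_le_one (norm_pos_iff.2 (Y_ne hU)) (by simpa using h2)


lemma int_eC (n : ℤ) : ∫ t in (0 : ℝ)..1, eC (n * (t : ℂ)) = if n = 0 then 1 else 0 := by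
  split_ifs with h
  · subst h; simp [eC_zero]
  · have hc : (2 * (Real.pi : ℂ) * I * n) ≠ 0 := by
      simp [Real.pi_ne_zero, h]
    have := integral_exp_mul_complex (a := 0) (b := 1) hc
    have e : ∀ t : ℝ, eC (n * (t : ℂ)) = Complex.exp (2 * (Real.pi : ℂ) * I * n * t) := by
      intro t; unfold eC; congr 1; ring
    simp_rw [e]
    rw [this]
    have e1 : Complex.exp (2 * (Real.pi : ℂ) * I * n * (1 : ℝ)) = 1 := by
      have := eC_int n
      unfold eC at this
      rw [← this]; congr 1; push_cast; ring
    rw [e1]; simp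

lemma four1 {d : ℤ → ℂ} (h : ∀ u : ℝ, HasSum (fun a : ℤ => d a * eC (a * (u : ℂ))) 0) (k : ℤ) : d k = 0 := by
  have hs : Summable fun a => ‖d a‖ := by
    have := (h 0).summable.norm
    simpa [eC_zero] using this
  let f : ℤ → C(ℝ, ℂ) := fun a => ⟨fun t : ℝ => d a * eC (((a - k : ℤ) : ℂ) * (t : ℂ)), by unfold eC; fun_prop⟩
  have hn : ∀ (a : ℤ) (t : ℝ), ‖f a t‖ = ‖d a‖ := by
    intro a t
    change ‖d a * eC (((a - k : ℤ) : ℂ) * (t : ℂ))‖ = _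
    rw [norm_mul, norm_eC]
    simp
  have hf : Summable fun i => ‖(f i).restrict (⟨Set.uIcc 0 1, isCompact_uIcc⟩ : TopologicalSpace.Compacts ℝ)‖ := by
    refine hs.of_nonneg_of_le (fun _ => norm_nonneg _) fun a => ?_
    rw [ContinuousMap.norm_le _ (norm_nonneg _)]
    intro x
    rw [ContinuousMap.restrict_apply, hn]
  have h1 := intervalIntegral.hasSum_intervalIntegral_of_summable_norm hf
  have h2 : ∀ t : ℝ, ∑' a, f a t = 0 := by
    intro t
    have := (h t).mul_right (eC (-k * t))
    rw [zero_mul] at this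
    rw [← this.tsum_eq]
    refine tsum_congr fun a => ?_
    change d a * eC (((a - k : ℤ) : ℂ) * (t : ℂ)) = _
    rw [mul_assoc, ← eC_add]; congr 2; push_cast; ring
  have h3 : ∀ a, ∫ t in (0 : ℝ)..1, f a t = if a = k then d k else 0 := by
    intro a
    change ∫ t in (0 : ℝ)..1, d a * eC (((a - k : ℤ) : ℂ) * (t : ℂ)) = _
    rw [intervalIntegral.integral_const_mul, int_eC]
    by_cases hak : a = k
    · subst hak; simp
    · simp [hak, sub_eq_zero]
  simp_rw [h2, h3] at h1
  have h4 := hasSum_ite_eq k (d k)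
  have := h1.unique h4
  simpa using this.symm

lemma four2z {d : ℤ × ℤ → ℂ} (h : ∀ u v : ℝ, HasSum (fun p : ℤ × ℤ => d p * eC (p.1 * (u : ℂ) + p.2 * (v : ℂ))) 0)
    (k : ℤ × ℤ) : d k = 0 := by
  have hs : Summable d := by simpa [eC_zero] using (h 0 0).summable
  have hb : ∀ (a : ℤ), Summable fun b => d (a, b) := fun a => hs.prod_factor a
  have hu : ∀ (u : ℝ), Summable fun p : ℤ × ℤ => d p * eC (p.2 * (u : ℂ)) := by
    intro u; simpa using (h 0 u).summable
  have key : ∀ (v : ℝ) (a : ℤ), HasSum (fun b : ℤ => d (a, b) * eC (b * (v : ℂ))) 0 := by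
    intro v a
    have h1 : ∀ a : ℤ, Summable fun b : ℤ => d (a, b) * eC (b * (v : ℂ)) := fun a => (hu v).prod_factor a
    have h2 : ∑' b : ℤ, d (a, b) * eC (b * (v : ℂ)) = 0 := by
      refine four1 (d := fun a => ∑' b : ℤ, d (a, b) * eC (b * (v : ℂ))) (fun u => ?_) a
      refine (h u v).prod_fiberwise fun a => ?_
      refine ((h1 a).hasSum.mul_right (eC (a * (u : ℂ)))).congr_fun fun b => ?_
      simp only [eC_add]; ring
    rw [← h2]; exact (h1 a).hasSum
  exact four1 (fun v => key v k.1) k.2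

lemma four2 {d d' : ℤ × ℤ → ℂ} {g : ℝ → ℝ → ℂ}
    (h : ∀ u v : ℝ, HasSum (fun p : ℤ × ℤ => d p * eC (p.1 * (u : ℂ) + p.2 * (v : ℂ))) (g u v))
    (h' : ∀ u v : ℝ, HasSum (fun p : ℤ × ℤ => d' p * eC (p.1 * (u : ℂ) + p.2 * (v : ℂ))) (g u v))
    (k : ℤ × ℤ) : d k = d' k := by
  rw [← sub_eq_zero]
  refine four2z (d := fun p => d p - d' p) (fun u v => ?_) k
  have := (h u v).sub (h' u v)
  rw [sub_self] at this
  exact this.congr_fun fun p => by ring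


def hC (c : ℕ → ℤ → ℤ → ℂ) (a b : ℤ) (τ : ℂ) : ℂ :=
  ∑' n : ℕ, c n a b * eC ((((n : ℝ) - ((a : ℝ) ^ 2 + (b : ℝ) ^ 2) / 8 : ℝ) : ℂ) * τ)

/-- the Fourier expansion hypothesis in `u, v` coordinates -/
def FE (c : ℕ → ℤ → ℤ → ℂ) (G : ℂ → ℂ → ℂ → ℂ) : Prop :=
  ∀ τ u v : ℂ, UHP τ → HasSum (fun p : ℕ × ℤ × ℤ => c p.1 p.2.1 p.2.2 *
    eC ((p.1 : ℂ) * τ + p.2.1 * u + p.2.2 * v)) (G τ u v)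

lemma FE_sum {c G} (h : FE c G) {τ : ℂ} (hτ : UHP τ) (a b : ℤ) :
    Summable fun n : ℕ => c n a b * eC ((n : ℂ) * τ) := by
  have h1 := (h τ 0 0 hτ).summable
  have h2 := h1.comp_injective (i := fun n : ℕ => (n, a, b)) (fun x y hxy => by simpa using hxy)
  simpa [Function.comp_def] using h2

lemma hC_sum {c G} (h : FE c G) (a b : ℤ) (τ : ℂ) (hτ : UHP τ) :
    Summable fun n : ℕ => c n a b * eC ((((n : ℝ) - ((a : ℝ) ^ 2 + (b : ℝ) ^ 2) / 8 : ℝ) : ℂ) * τ) := by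
  refine ((FE_sum h hτ a b).mul_right (eC (-((a : ℂ) ^ 2 + (b : ℂ) ^ 2) / 8 * τ))).congr fun n => ?_
  rw [mul_assoc, ← eC_add]; congr 2; push_cast; ring

lemma FE_hC {c G} (h : FE c G) {τ : ℂ} (hτ : UHP τ) (u v : ℂ) :
    HasSum (fun p : ℤ × ℤ => hC c p.1 p.2 τ * eC (((p.1 : ℂ) ^ 2 + (p.2 : ℂ) ^ 2) / 8 * τ) *
      eC (p.1 * u + p.2 * v)) (G τ u v) := by
  have h1 := h τ u v hτ
  have h2 := (Equiv.prodComm (ℤ × ℤ) ℕ).hasSum_iff.2 h1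
  refine h2.prod_fiberwise fun p => ?_
  have h3 := (hC_sum h p.1 p.2 τ hτ).hasSum
  have h4 := h3.mul_right (eC (((p.1 : ℂ) ^ 2 + (p.2 : ℂ) ^ 2) / 8 * τ) * eC (p.1 * u + p.2 * v))
  rw [mul_assoc]
  refine h4.congr_fun fun n => ?_
  simp only [Function.comp_apply, Equiv.prodComm_apply, Prod.swap_prod_mk]
  rw [mul_assoc, ← eC_add, ← eC_add]; congr 2; push_cast; ring

lemma hC_unique {c G} (h : FE c G) {τ : ℂ} (hτ : UHP τ) {d : ℤ × ℤ → ℂ}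
    (hd : ∀ u v : ℝ, HasSum (fun p : ℤ × ℤ => d p * eC (p.1 * (u : ℂ) + p.2 * (v : ℂ))) (G τ u v)) (a b : ℤ) :
    hC c a b τ * eC (((a : ℂ) ^ 2 + (b : ℂ) ^ 2) / 8 * τ) = d (a, b) :=
  four2 (d := fun p => hC c p.1 p.2 τ * eC (((p.1 : ℂ) ^ 2 + (p.2 : ℂ) ^ 2) / 8 * τ))
    (g := fun u v => G τ u v) (fun u v => FE_hC h hτ u v) hd (a, b)

lemma hC_rot {c G} (h : FE c G) {τ : ℂ} (hτ : UHP τ) (hr : ∀ u v, G τ v (-u) = G τ u v) (a b : ℤ) :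
    hC c b (-a) τ = hC c a b τ := by
  have := hC_unique h hτ (d := fun p => hC c p.2 (-p.1) τ * eC (((p.1 : ℂ) ^ 2 + (p.2 : ℂ) ^ 2) / 8 * τ)) (fun u v => ?_) a b
  · exact (mul_right_cancel₀ (eC_ne _) this).symm
  · have h1 := FE_hC h hτ v (-u)
    rw [hr] at h1
    let e : ℤ × ℤ ≃ ℤ × ℤ := ⟨fun p => (p.2, -p.1), fun p => (-p.2, p.1), fun p => by simp, fun p => by simp⟩
    refine (e.hasSum_iff.2 h1).congr_fun fun p => ?_
    simp only [Function.comp_apply, e, Equiv.coe_fn_mk]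
    push_cast
    congr 2
    · congr 1; ring
    · ring

lemma hC_per {c G} (h : FE c G) {τ : ℂ} (hτ : UHP τ) (p : ℤ)
    (hr : ∀ u v, G τ (u + p * τ) v = eC (-2 * (p ^ 2 * τ + 2 * p * u)) * G τ u v) (a b : ℤ) :
    hC c (a + 4 * p) b τ = hC c a b τ := by
  have := hC_unique h hτ (d := fun k => hC c (k.1 + 4 * p) k.2 τ * eC (((k.1 : ℂ) ^ 2 + (k.2 : ℂ) ^ 2) / 8 * τ)) (fun u v => ?_) a b
  · exact (mul_right_cancel₀ (eC_ne _) this).symm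
  · have h1 := FE_hC h hτ (u + p * τ - 4 * 0) v
    have h1 := FE_hC h hτ (u - p * τ) v
    have h2 := hr (u - p * τ) v
    rw [sub_add_cancel] at h2
    rw [h2]
    have h1 := h1.mul_left (eC (-2 * (p ^ 2 * τ + 2 * p * (u - p * τ))))
    let e : ℤ × ℤ ≃ ℤ × ℤ := ⟨fun k => (k.1 + 4 * p, k.2), fun k => (k.1 - 4 * p, k.2), fun p => by simp, fun p => by simp⟩
    refine (e.hasSum_iff.2 h1).congr_fun fun k => ?_
    simp only [Function.comp_apply, e, Equiv.coe_fn_mk]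
    push_cast
    have hq : eC (((k.1 : ℂ) ^ 2 + (k.2 : ℂ) ^ 2) / 8 * τ) * eC (k.1 * (u : ℂ) + k.2 * v) =
        eC (-2 * (p ^ 2 * τ + 2 * p * (u - p * τ))) * eC ((((k.1 : ℂ) + 4 * p) ^ 2 + (k.2 : ℂ) ^ 2) / 8 * τ) *
        eC (((k.1 : ℂ) + 4 * p) * (u - p * τ) + k.2 * v) := by
      simp only [← eC_add]; congr 1; ring
    linear_combination hC c (k.1 + 4 * p) k.2 τ * hq

def eSplit : (Fin 4 × Fin 4) × (ℤ × ℤ) ≃ ℤ × ℤ where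
  toFun x := ((Int.divModEquiv 4).symm (x.2.1, x.1.1), (Int.divModEquiv 4).symm (x.2.2, x.1.2))
  invFun k := (((Int.divModEquiv 4 k.1).2, (Int.divModEquiv 4 k.2).2), ((Int.divModEquiv 4 k.1).1, (Int.divModEquiv 4 k.2).1))
  left_inv x := by simp only [Equiv.apply_symm_apply]
  right_inv k := by simp only [Prod.mk.eta, Equiv.symm_apply_apply]

lemma eSplit_apply (x : (Fin 4 × Fin 4) × (ℤ × ℤ)) :
    eSplit x = (((x.1.1 : ℕ) : ℤ) + 4 * x.2.1, ((x.1.2 : ℕ) : ℤ) + 4 * x.2.2) := by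
  simp only [eSplit, Equiv.coe_fn_mk, Int.divModEquiv_symm_apply]
  push_cast
  rw [add_comm, mul_comm, add_comm (x.2.2 * 4), mul_comm x.2.2]

lemma th_prod {τ : ℂ} (hτ : UHP τ) (u v : ℂ) (a b : ℤ) :
    HasSum (fun g : ℤ × ℤ => eC ((((a + 4 * g.1 : ℤ) : ℂ) ^ 2 + ((b + 4 * g.2 : ℤ) : ℂ) ^ 2) / 8 * τ) *
      eC (((a + 4 * g.1 : ℤ) : ℂ) * u + ((b + 4 * g.2 : ℤ) : ℂ) * v)) (th a τ u * th b τ v) := by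
  have s1 := hasSum_th a hτ u
  have s2 := hasSum_th b hτ v
  have s4 := summable_mul_of_summable_norm s1.summable.norm s2.summable.norm
  have s3 : HasSum (fun g : ℤ × ℤ => eC (((a : ℂ) + 4 * g.1) ^ 2 / 8 * τ + ((a : ℂ) + 4 * g.1) * u) *
    eC (((b : ℂ) + 4 * g.2) ^ 2 / 8 * τ + ((b : ℂ) + 4 * g.2) * v)) (th a τ u * th b τ v) := by
    have h5 := tsum_mul_tsum_of_summable_norm s1.summable.norm s2.summable.norm
    rw [s1.tsum_eq, s2.tsum_eq] at h5
    rw [h5]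
    exact s4.hasSum
  have e : ∀ g : ℤ × ℤ, eC ((((a + 4 * g.1 : ℤ) : ℂ) ^ 2 + ((b + 4 * g.2 : ℤ) : ℂ) ^ 2) / 8 * τ) *
      eC (((a + 4 * g.1 : ℤ) : ℂ) * u + ((b + 4 * g.2 : ℤ) : ℂ) * v) = eC (((a : ℂ) + 4 * g.1) ^ 2 / 8 * τ + ((a : ℂ) + 4 * g.1) * u) *
    eC (((b : ℂ) + 4 * g.2) ^ 2 / 8 * τ + ((b : ℂ) + 4 * g.2) * v) := by
    intro g
    rw [← eC_add, ← eC_add]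
    congr 1
    push_cast
    ring
  simp_rw [e]
  exact s3

lemma th_decomp {c G} (h : FE c G) {τ : ℂ} (hτ : UHP τ)
    (hp : ∀ a b p q : ℤ, hC c (a + 4 * p) (b + 4 * q) τ = hC c a b τ) (u v : ℂ) :
    G τ u v = ∑ k : Fin 4 × Fin 4, hC c ((k.1 : ℕ) : ℤ) ((k.2 : ℕ) : ℤ) τ *
      (th ((k.1 : ℕ) : ℤ) τ u * th ((k.2 : ℕ) : ℤ) τ v) := by
  have h1 := eSplit.hasSum_iff.2 (FE_hC h hτ u v)
  have h2 : HasSum (fun k : Fin 4 × Fin 4 => hC c ((k.1 : ℕ) : ℤ) ((k.2 : ℕ) : ℤ) τ *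
      (th ((k.1 : ℕ) : ℤ) τ u * th ((k.2 : ℕ) : ℤ) τ v)) (G τ u v) := by
    refine h1.prod_fiberwise fun k => ?_
    have s3 := (th_prod hτ u v ((k.1 : ℕ) : ℤ) ((k.2 : ℕ) : ℤ)).mul_left (hC c ((k.1 : ℕ) : ℤ) ((k.2 : ℕ) : ℤ) τ)
    refine s3.congr_fun fun g => ?_
    simp only [Function.comp_apply, eSplit_apply, hp]
    rw [mul_assoc]
  exact h2.unique (hasSum_fintype _)


def GU (φ : ℂ → ℂ → ℂ → ℂ) (τ u v : ℂ) : ℂ := φ τ (u - I * v) (u + I * v)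

lemma GU_FE {φ : ℂ → ℂ → ℂ → ℂ} {c : ℕ → ℤ → ℤ → ℂ} (h : ∀ τ z₁ z₂ : ℂ, UHP τ →
        HasSum (fun p : ℕ × ℤ × ℤ => c p.1 p.2.1 p.2.2 *
          eC ((p.1 : ℂ) * τ + (((p.2.1 : ℂ) + (p.2.2 : ℂ) * Complex.I) / 2) * z₁
            + (((p.2.1 : ℂ) - (p.2.2 : ℂ) * Complex.I) / 2) * z₂)) (φ τ z₁ z₂)) : FE c (GU φ) := by
  intro τ u v hτ
  refine (h τ (u - I * v) (u + I * v) hτ).congr_fun fun p => ?_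
  congr 2
  linear_combination (p.2.2 * v) * I_sq

lemma GU_rot {φ} (h : IsHJF 4 2 φ) {τ : ℂ} (hτ : UHP τ) (u v : ℂ) : GU φ τ v (-u) = GU φ τ u v := by
  have := h.transf I (by simp) 1 τ (u - I * v) (u + I * v) hτ
  simp only [Ma, Mb, Mc, Md] at this
  norm_num [eC_zero] at this
  unfold GU
  rw [← this]
  congr 1
  · linear_combination v * I_sq
  · linear_combination v * I_sq

lemma GU_T {φ} (h : IsHJF 4 2 φ) {τ : ℂ} (hτ : UHP τ) (u v : ℂ) : GU φ (τ + 1) u v = GU φ τ u v := by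
  have := h.transf 1 (by simp) ModularGroup.T τ (u - I * v) (u + I * v) hτ
  simp only [Ma, Mb, Mc, Md, ModularGroup.T] at this
  norm_num [eC_zero] at this
  exact this

lemma GU_S {φ} (h : IsHJF 4 2 φ) {τ : ℂ} (hτ : UHP τ) (u v : ℂ) :
    GU φ (-1 / τ) (u / τ) (v / τ) = τ ^ 4 * eC (2 * (u ^ 2 + v ^ 2) / τ) * GU φ τ u v := by
  have := h.transf 1 (by simp) ModularGroup.S τ (u - I * v) (u + I * v) hτ
  simp only [Ma, Mb, Mc, Md, ModularGroup.S] at this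
  norm_num at this
  unfold GU
  have e : 2 * (u - I * v) * (u + I * v) = 2 * (u ^ 2 + v ^ 2) := by linear_combination (-2 * v ^ 2) * I_sq
  rw [e] at this
  rw [← this]
  congr 1 <;> ring

lemma GU_ell {φ} (h : IsHJF 4 2 φ) {τ : ℂ} (hτ : UHP τ) (p : ℤ) (u v : ℂ) :
    GU φ τ (u + p * τ) v = eC (-2 * (p ^ 2 * τ + 2 * p * u)) * GU φ τ u v := by
  have := h.ellip p 0 0 0 τ (u - I * v) (u + I * v) hτ
  unfold GU
  norm_num at this
  rw [show u + p * τ - I * v = u - I * v + p * τ by ring, show u + p * τ + I * v = u + I * v + p * τ by ring, this]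
  congr 2
  ring

lemma hC_diff {c G} (h : FE c G) (hc : ∀ (n : ℕ) (a b : ℤ), 4 * (n : ℤ) * (2 : ℕ) < a ^ 2 + b ^ 2 → c n a b = 0) (a b : ℤ) :
    DifferentiableOn ℂ (hC c a b) {τ | UHP τ} := by
  refine lemG_holo (hC_sum h a b) fun n hn => ?_
  have h1 := not_lt.1 (fun h' => hn (hc n a b h'))
  have h2 : ((a : ℝ) ^ 2 + (b : ℝ) ^ 2) ≤ 4 * n * 2 := by exact_mod_cast h1
  linarith

lemma hC_bd {c G} (h : FE c G) (hc : ∀ (n : ℕ) (a b : ℤ), 4 * (n : ℤ) * (2 : ℕ) < a ^ 2 + b ^ 2 → c n a b = 0) (a b : ℤ)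
    (N0 : ℝ) (k : ℕ) (hk : N0 = k / 8)
    (hN : ∀ n : ℕ, a ^ 2 + b ^ 2 ≤ 8 * (n : ℤ) → (k : ℤ) + a ^ 2 + b ^ 2 ≤ 8 * (n : ℤ)) :
    ∃ K : ℝ, 0 ≤ K ∧ ∀ τ : ℂ, 1 ≤ τ.im → ‖hC c a b τ‖ ≤ K * ‖eC (1 / 8 * τ)‖ ^ k := by
  obtain ⟨K, h0, hK⟩ := lemG_bound (N0 := N0) (hC_sum h a b) (fun n hn => by
    have h1 := not_lt.1 (fun h' => hn (hc n a b h'))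
    have h2 := hN n (by push_cast at h1; linarith)
    have h3 : (k : ℝ) + (a : ℝ) ^ 2 + (b : ℝ) ^ 2 ≤ 8 * (n : ℝ) := by exact_mod_cast h2
    rw [hk]; linarith)
  refine ⟨K, h0, fun τ hτ => ?_⟩
  have := hK τ hτ
  rw [← norm_pow, ← eC_nat_mul, show (k : ℂ) * (1 / 8 * τ) = (N0 : ℂ) * τ by rw [hk]; push_cast; ring]
  exact this

lemma dec_exists {φ} (h : IsHJF 4 2 φ) : ∃ A B C D E F : ℂ → ℂ,
    (DifferentiableOn ℂ A {τ | UHP τ} ∧ DifferentiableOn ℂ B {τ | UHP τ} ∧ DifferentiableOn ℂ C {τ | UHP τ} ∧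
     DifferentiableOn ℂ D {τ | UHP τ} ∧ DifferentiableOn ℂ E {τ | UHP τ} ∧ DifferentiableOn ℂ F {τ | UHP τ}) ∧
    (∃ K : ℝ, 0 ≤ K ∧ ∀ τ : ℂ, 1 ≤ τ.im → ‖A τ‖ ≤ K ∧ ‖B τ‖ ≤ K ∧ ‖C τ‖ ≤ K * ‖eC (1 / 8 * τ)‖ ^ 6 ∧
      ‖D τ‖ ≤ K ∧ ‖E τ‖ ≤ K * ‖eC (1 / 8 * τ)‖ ^ 3 ∧ ‖F τ‖ ≤ K * ‖eC (1 / 8 * τ)‖ ^ 3) ∧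
    ∀ τ u v, UHP τ → GU φ τ u v = A τ * (TX τ u * TX τ v) + B τ * (TY τ u * TY τ v) + C τ * (TZ τ u * TZ τ v)
      + D τ * (TX τ u * TY τ v + TY τ u * TX τ v) + E τ * (TX τ u * TZ τ v + TZ τ u * TX τ v)
      + F τ * (TY τ u * TZ τ v + TZ τ u * TY τ v) := by
  obtain ⟨c, hc, hf⟩ := h.fourier
  have hF := GU_FE hf
  have d := hC_diff hF hc
  obtain ⟨K1, p1, b1⟩ := hC_bd hF hc 0 0 0 0 (by norm_num) (by intro n hn; push_cast; linarith)
  obtain ⟨K2, p2, b2⟩ := hC_bd hF hc 2 2 0 0 (by norm_num) (by intro n hn; push_cast; linarith)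
  obtain ⟨K3, p3, b3⟩ := hC_bd hF hc 0 2 0 0 (by norm_num) (by intro n hn; push_cast; linarith)
  obtain ⟨K4, p4, b4⟩ := hC_bd hF hc 1 1 (6 / 8) 6 (by norm_num) (by intro n hn; push_cast; omega)
  obtain ⟨K5, p5, b5⟩ := hC_bd hF hc 0 1 (3 / 8) 3 (by norm_num) (by intro n hn; push_cast; omega)
  obtain ⟨K6, p6, b6⟩ := hC_bd hF hc 1 2 (3 / 8) 3 (by norm_num) (by intro n hn; push_cast; omega)
  refine ⟨fun τ => (hC c 0 0 τ + hC c 2 2 τ + 2 * hC c 0 2 τ) / 4,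
    fun τ => (hC c 0 0 τ + hC c 2 2 τ - 2 * hC c 0 2 τ) / 4, hC c 1 1,
    fun τ => (hC c 0 0 τ - hC c 2 2 τ) / 4, fun τ => (hC c 0 1 τ + hC c 1 2 τ) / 2,
    fun τ => (hC c 0 1 τ - hC c 1 2 τ) / 2, ⟨?_, ?_, d 1 1, ?_, ?_, ?_⟩, ⟨K1 + K2 + K3 + K4 + K5 + K6, by positivity, ?_⟩, ?_⟩
  · exact (((d 0 0).add (d 2 2)).add ((d 0 2).const_mul 2)).div_const 4
  · exact (((d 0 0).add (d 2 2)).sub ((d 0 2).const_mul 2)).div_const 4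
  · exact ((d 0 0).sub (d 2 2)).div_const 4
  · exact ((d 0 1).add (d 1 2)).div_const 2
  · exact ((d 0 1).sub (d 1 2)).div_const 2
  · intro τ hτ
    have b1 := b1 τ hτ
    have b2 := b2 τ hτ
    have b3 := b3 τ hτ
    have b4 := b4 τ hτ
    have b5 := b5 τ hτ
    have b6 := b6 τ hτ
    rw [pow_zero, mul_one] at b1 b2 b3
    have n2 : ‖(2 : ℂ)‖ = 2 := by simp
    have n4 : ‖(4 : ℂ)‖ = 4 := by simp
    have q3 : 0 ≤ ‖eC (1 / 8 * τ)‖ ^ 3 := by positivity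
    have q6 : 0 ≤ ‖eC (1 / 8 * τ)‖ ^ 6 := by positivity
    have t1 := norm_add_le (hC c 0 0 τ + hC c 2 2 τ) (2 * hC c 0 2 τ)
    have t2 := norm_add_le (hC c 0 0 τ) (hC c 2 2 τ)
    have t3 := norm_sub_le (hC c 0 0 τ + hC c 2 2 τ) (2 * hC c 0 2 τ)
    have t4 := norm_sub_le (hC c 0 0 τ) (hC c 2 2 τ)
    have t5 := norm_add_le (hC c 0 1 τ) (hC c 1 2 τ)
    have t6 := norm_sub_le (hC c 0 1 τ) (hC c 1 2 τ)
    rw [norm_mul, n2] at t1 t3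
    simp only [norm_div, n2, n4]
    refine ⟨by linarith, by linarith, ?_, by linarith, ?_, ?_⟩
    · nlinarith [mul_nonneg (add_nonneg (add_nonneg (add_nonneg (add_nonneg p1 p2) p3) p5) p6) q6]
    · nlinarith [mul_nonneg (add_nonneg (add_nonneg (add_nonneg (add_nonneg p1 p2) p3) p4) (add_nonneg p5 p6)) q3]
    · nlinarith [mul_nonneg (add_nonneg (add_nonneg (add_nonneg (add_nonneg p1 p2) p3) p4) (add_nonneg p5 p6)) q3]
  · intro τ u v hτ
    have r := hC_rot hF hτ (GU_rot h hτ)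
    have p1 : ∀ a b p : ℤ, hC c (a + 4 * p) b τ = hC c a b τ := fun a b p => hC_per hF hτ p (GU_ell h hτ p) a b
    have p2 : ∀ a b q : ℤ, hC c a (b + 4 * q) τ = hC c a b τ := by
      intro a b q
      rw [← r, p1, r]
    have e := th_decomp hF hτ (fun a b p q => by rw [p1, p2]) u v
    rw [Fintype.sum_prod_type] at e
    simp only [Fin.sum_univ_four] at e
    have f0 : (((0 : Fin 4) : ℕ) : ℤ) = 0 := rfl
    have f1 : (((1 : Fin 4) : ℕ) : ℤ) = 1 := rfl
    have f2 : (((2 : Fin 4) : ℕ) : ℤ) = 2 := rfl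
    have f3 : (((3 : Fin 4) : ℕ) : ℤ) = 3 := rfl
    simp only [f0, f1, f2, f3] at e
    have s20 := r 0 2
    have s10 := r 0 1
    have s30 := r 0 3
    have s03 := r 1 0
    have s23 := r 1 2
    have s12 := r 2 1
    have s32 := r 2 3
    have s13 := r 1 1
    have s33 := r 1 3
    have s31 := r 3 1
    have n1 : ∀ a, hC c a (-1) τ = hC c a 3 τ := fun a => by have := p2 a (-1) 1; norm_num at this; exact this.symm
    have n2 : ∀ a, hC c a (-2) τ = hC c a 2 τ := fun a => by have := p2 a (-2) 1; norm_num at this; exact this.symm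
    have n3 : ∀ a, hC c a (-3) τ = hC c a 1 τ := fun a => by have := p2 a (-3) 1; norm_num at this; exact this.symm
    simp only [n1, n2, n3, neg_zero] at s20 s10 s30 s03 s23 s12 s32 s13 s33 s31
    have s03' := s03.trans s10
    rw [e, s20, s30, s32, s33, s23, s13, s10, s03', ← s12, ← s31, TX_eq hτ, TX_eq hτ, TY_eq hτ, TY_eq hτ, TZ_eq hτ, TZ_eq hτ]
    ring


lemma th_half (a : ℤ) (τ : ℂ) : th a τ (1 / 2) = eC (a / 2) * th a τ 0 := by
  unfold th
  rw [← tsum_mul_left]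
  refine tsum_congr fun g => ?_
  rw [← eC_add, ← eC_add_int (_ + _) (-(2 * g))]
  congr 1
  push_cast
  ring

lemma th_tau (a : ℤ) (τ : ℂ) : th a τ (τ / 2) = eC (-τ / 2) * th (a + 2) τ 0 := by
  unfold th
  rw [← tsum_mul_left]
  refine tsum_congr fun g => ?_
  rw [← eC_add]
  congr 1
  push_cast
  ring

lemma indep1 {τ a b c : ℂ} (hτ : UHP τ) (h : ∀ u, a * TX τ u + b * TY τ u + c * TZ τ u = 0) :
    a = 0 ∧ b = 0 ∧ c = 0 := by
  have x := X_ne hτ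
  have y := Y_ne hτ
  have z := Z_ne hτ
  have h0 := h 0
  have h1 := h (1 / 2)
  have h2 := h (τ / 2)
  have e1 : TX τ (1 / 2) = TX τ 0 := by
    rw [TX_eq hτ, TX_eq hτ, th_half, th_half]; norm_num [eC_zero, eC_one]
  have e2 : TY τ (1 / 2) = TY τ 0 := by
    rw [TY_eq hτ, TY_eq hτ, th_half, th_half]; norm_num [eC_zero, eC_one]
  have h3 : eC (3 / 2) = -1 := by
    rw [show (3 / 2 : ℂ) = 1 / 2 + 1 by norm_num, eC_add, eC_one, eC_half]; ring
  have e3 : TZ τ (1 / 2) = -TZ τ 0 := by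
    rw [TZ_eq hτ, TZ_eq hτ, th_half, th_half]; push_cast; rw [h3, eC_half]; ring
  have t4 : th 4 τ 0 = th 0 τ 0 := th_add4 0 τ 0
  have t5 : th 5 τ 0 = th 1 τ 0 := th_add4 1 τ 0
  have e4 : TX τ (τ / 2) = eC (-τ / 2) * TX τ 0 := by
    rw [TX_eq hτ, TX_eq hτ, th_tau, th_tau]; norm_num; rw [t4]; ring
  have e5 : TY τ (τ / 2) = -eC (-τ / 2) * TY τ 0 := by
    rw [TY_eq hτ, TY_eq hτ, th_tau, th_tau]; norm_num; rw [t4]; ring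
  have e6 : TZ τ (τ / 2) = eC (-τ / 2) * TZ τ 0 := by
    rw [TZ_eq hτ, TZ_eq hτ, th_tau, th_tau]; norm_num; rw [t5]; ring
  rw [e1, e2, e3] at h1
  rw [e4, e5, e6] at h2
  have h2' : a * TX τ 0 - b * TY τ 0 + c * TZ τ 0 = 0 := by
    refine (mul_eq_zero.1 (?_ : eC (-τ / 2) * _ = 0)).resolve_left (eC_ne _)
    linear_combination h2
  have hc : c * TZ τ 0 = 0 := by linear_combination (h0 - h1) / 2
  have hb : b * TY τ 0 = 0 := by linear_combination (h0 - h2') / 2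
  have ha : a * TX τ 0 = 0 := by linear_combination (h1 + h2') / 2
  exact ⟨(mul_eq_zero.1 ha).resolve_right x, (mul_eq_zero.1 hb).resolve_right y, (mul_eq_zero.1 hc).resolve_right z⟩

/-- symmetric combination -/
def SC (A B C D E F τ u v : ℂ) : ℂ :=
  A * (TX τ u * TX τ v) + B * (TY τ u * TY τ v) + C * (TZ τ u * TZ τ v)
      + D * (TX τ u * TY τ v + TY τ u * TX τ v) + E * (TX τ u * TZ τ v + TZ τ u * TX τ v)
      + F * (TY τ u * TZ τ v + TZ τ u * TY τ v)

lemma indep2z {τ A B C D E F : ℂ} (hτ : UHP τ) (h : ∀ u v, SC A B C D E F τ u v = 0) :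
    A = 0 ∧ B = 0 ∧ C = 0 ∧ D = 0 ∧ E = 0 ∧ F = 0 := by
  have k : ∀ v, A * TX τ v + D * TY τ v + E * TZ τ v = 0 ∧ D * TX τ v + B * TY τ v + F * TZ τ v = 0 ∧
      E * TX τ v + F * TY τ v + C * TZ τ v = 0 := by
    intro v
    refine indep1 hτ fun u => ?_
    have := h u v
    unfold SC at this
    linear_combination this
  obtain ⟨h1, h2, h3⟩ := indep1 hτ fun v => (k v).1
  obtain ⟨h4, h5, h6⟩ := indep1 hτ fun v => (k v).2.1
  obtain ⟨h7, h8, h9⟩ := indep1 hτ fun v => (k v).2.2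
  exact ⟨h1, h5, h9, h2, h3, h6⟩

lemma indep2 {τ A B C D E F A' B' C' D' E' F' : ℂ} (hτ : UHP τ)
    (h : ∀ u v, SC A B C D E F τ u v = SC A' B' C' D' E' F' τ u v) :
    A = A' ∧ B = B' ∧ C = C' ∧ D = D' ∧ E = E' ∧ F = F' := by
  have := indep2z (A := A - A') (B := B - B') (C := C - C') (D := D - D') (E := E - E') (F := F - F') hτ (fun u v => by
    have := h u v
    unfold SC at this ⊢
    linear_combination this)
  simpa only [sub_eq_zero] using this

lemma uhp_S {τ : ℂ} (h : UHP τ) : UHP (-1 / τ) := by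
  have := mob_UHP ModularGroup.S h
  simpa [Ma, Mb, Mc, Md, ModularGroup.S] using this

lemma uhp_T {τ : ℂ} (h : UHP τ) : UHP (τ + 1) := by simpa [UHP] using h

lemma uhp_conv : IsPreconnected {τ : ℂ | UHP τ} := by
  have : Convex ℝ {τ : ℂ | UHP τ} := convex_halfSpace_im_gt 0
  exact this.isPreconnected

lemma triple {f g k : ℂ → ℂ} (df : DifferentiableOn ℂ f {τ | UHP τ}) (dg : DifferentiableOn ℂ g {τ | UHP τ})
    (dk : DifferentiableOn ℂ k {τ | UHP τ})
    (hb : ∃ A B : ℝ, ∀ τ : ℂ, UHP τ → B ≤ τ.im → ‖f τ‖ ≤ A ∧ ‖g τ‖ ≤ A ∧ ‖k τ‖ ≤ A)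
    (T1 : ∀ τ, UHP τ → f (τ + 1) = g τ) (T2 : ∀ τ, UHP τ → g (τ + 1) = f τ) (T3 : ∀ τ, UHP τ → k (τ + 1) = k τ)
    (S1 : ∀ τ, UHP τ → f (-1 / τ) = f τ) (S2 : ∀ τ, UHP τ → g (-1 / τ) = k τ) (S3 : ∀ τ, UHP τ → k (-1 / τ) = g τ) :
    ∃ C, ∀ τ, UHP τ → f τ = C ∧ g τ = C ∧ k τ = C := by
  obtain ⟨A, B, hb⟩ := hb
  set l := f I with hl
  have tT : ∀ {p q : ℂ → ℂ}, (∀ τ, UHP τ → p (τ + 1) = q τ) → (∀ τ, UHP τ → p τ = l) → ∀ τ, UHP τ → q τ = l :=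
    fun h h' τ hτ => by rw [← h τ hτ]; exact h' _ (uhp_T hτ)
  have tS : ∀ {p q : ℂ → ℂ}, (∀ τ, UHP τ → p (-1 / τ) = q τ) → (∀ τ, UHP τ → p τ = l) → ∀ τ, UHP τ → q τ = l :=
    fun h h' τ hτ => by rw [← h τ hτ]; exact h' _ (uhp_S hτ)
  have dconst : DifferentiableOn ℂ (fun _ : ℂ => l) {τ | UHP τ} := differentiableOn_const l
  obtain ⟨C, hC⟩ := W0 (f := fun τ => (f τ - l) * (g τ - l) * (k τ - l))
    (((df.sub dconst).mul (dg.sub dconst)).mul (dk.sub dconst))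
    (fun τ h => by simp only [T1 τ h, T2 τ h, T3 τ h]; ring)
    (fun τ h => by simp only [S1 τ h, S2 τ h, S3 τ h]; ring)
    ⟨(A + ‖l‖) * (A + ‖l‖) * (A + ‖l‖), B, fun τ h hB => by
      obtain ⟨h1, h2, h3⟩ := hb τ h hB
      have b1 : ‖f τ - l‖ ≤ A + ‖l‖ := (norm_sub_le _ _).trans (by linarith)
      have b2 : ‖g τ - l‖ ≤ A + ‖l‖ := (norm_sub_le _ _).trans (by linarith)
      have b3 : ‖k τ - l‖ ≤ A + ‖l‖ := (norm_sub_le _ _).trans (by linarith)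
      have : 0 ≤ A + ‖l‖ := (norm_nonneg _).trans b1
      rw [norm_mul, norm_mul]
      gcongr⟩
  have hC0 : C = 0 := by rw [← hC I UI]; simp [hl]
  subst hC0
  have an : ∀ {p : ℂ → ℂ}, DifferentiableOn ℂ p {τ | UHP τ} → AnalyticOnNhd ℂ (fun τ => p τ - l) {τ | UHP τ} :=
    fun h => (h.sub dconst).analyticOnNhd uhp_open
  have key : (∀ τ, UHP τ → f τ = l) ∨ (∀ τ, UHP τ → g τ = l) ∨ (∀ τ, UHP τ → k τ = l) := by
    have z1 := ((an df).mul (an dg)).eq_zero_or_eq_zero_of_mul_eq_zero (an dk) (fun τ h => hC τ h) uhp_conv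
    rcases z1 with z1 | z1
    · rcases (an df).eq_zero_or_eq_zero_of_mul_eq_zero (an dg) (fun τ h => z1 τ h) uhp_conv with z | z
      · exact Or.inl fun τ h => sub_eq_zero.1 (z τ h)
      · exact Or.inr (Or.inl fun τ h => sub_eq_zero.1 (z τ h))
    · exact Or.inr (Or.inr fun τ h => sub_eq_zero.1 (z1 τ h))
  refine ⟨l, ?_⟩
  have hg : ∀ τ, UHP τ → g τ = l := by
    rcases key with h | h | h
    · exact tT T1 h
    · exact h
    · exact tS S3 h
  exact fun τ hτ => ⟨tT T2 hg τ hτ, hg τ hτ, tS S2 hg τ hτ⟩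


lemma main4 {φ} (h : IsHJF 4 2 φ) : ∃ c₁ c₂ : ℂ, ∀ τ u v, UHP τ → GU φ τ u v = c₁ * G1 τ u v + c₂ * G2 τ u v := by
  obtain ⟨A, B, C, D, E, F, ⟨dA, dB, dC, dD, dE, dF⟩, ⟨K, hK0, hK⟩, hexp⟩ := dec_exists h
  have hexp : ∀ τ u v, UHP τ → GU φ τ u v = SC (A τ) (B τ) (C τ) (D τ) (E τ) (F τ) τ u v := hexp
  have lT : ∀ τ, UHP τ → B (τ + 1) = A τ ∧ A (τ + 1) = B τ ∧ eC (1 / 8) ^ 2 * C (τ + 1) = C τ ∧ D (τ + 1) = D τ ∧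
      eC (1 / 8) * F (τ + 1) = E τ ∧ eC (1 / 8) * E (τ + 1) = F τ := by
    intro τ hτ
    refine indep2 hτ fun u v => ?_
    rw [← hexp τ u v hτ, ← GU_T h hτ, hexp _ u v (uhp_T hτ)]
    simp only [SC, TX_T, TY_T, TZ_T]
    ring
  have lS : ∀ τ, UHP τ → sqf τ ^ 2 * A (-1 / τ) = τ ^ 4 * A τ ∧ sqf τ ^ 2 * C (-1 / τ) = τ ^ 4 * B τ ∧
      sqf τ ^ 2 * B (-1 / τ) = τ ^ 4 * C τ ∧ sqf τ ^ 2 * E (-1 / τ) = τ ^ 4 * D τ ∧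
      sqf τ ^ 2 * D (-1 / τ) = τ ^ 4 * E τ ∧ sqf τ ^ 2 * F (-1 / τ) = τ ^ 4 * F τ := by
    intro τ hτ
    refine indep2 hτ fun u v => ?_
    have h1 := GU_S h hτ u v
    rw [hexp _ _ _ (uhp_S hτ), hexp τ u v hτ, eC_uv] at h1
    simp only [SC, TX_S hτ, TY_S hτ, TZ_S hτ] at h1 ⊢
    refine mul_left_cancel₀ (mul_ne_zero (eC_ne (2 * u ^ 2 / τ)) (eC_ne (2 * v ^ 2 / τ))) ?_
    linear_combination h1
  obtain ⟨M, B0, hM0, hB1, hM⟩ := inv_bd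
  have zz := zeta4
  have zn := eC_ne (1 / 8)
  obtain ⟨c₁, h₁⟩ := triple (f := fun τ => A τ / TX τ 0 ^ 6) (g := fun τ => B τ / TY τ 0 ^ 6) (k := fun τ => C τ / TZ τ 0 ^ 6)
    (dA.div (dX.pow 6) fun τ hτ => pow_ne_zero _ (X_ne hτ)) (dB.div (dY.pow 6) fun τ hτ => pow_ne_zero _ (Y_ne hτ))
    (dC.div (dZ.pow 6) fun τ hτ => pow_ne_zero _ (Z_ne hτ))
    ⟨K * M ^ 6, B0, fun τ hτ hB => by
      obtain ⟨m1, m2, m3⟩ := hM τ hB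
      obtain ⟨k1, k2, k3, k4, k5, k6⟩ := hK τ (hB1.trans hB)
      simp only [div_eq_mul_inv, ← inv_pow, norm_mul, norm_pow]
      refine ⟨by gcongr, by gcongr, ?_⟩
      calc _ ≤ K * ‖eC (1 / 8 * τ)‖ ^ 6 * ‖(TZ τ 0)⁻¹‖ ^ 6 := by gcongr
        _ = K * (‖eC (1 / 8 * τ)‖ * ‖(TZ τ 0)⁻¹‖) ^ 6 := by ring
        _ ≤ _ := by gcongr⟩
    (fun τ hτ => by simp only [TX_T, (lT τ hτ).2.1])
    (fun τ hτ => by simp only [TY_T, (lT τ hτ).1])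
    (fun τ hτ => by
      have z := Z_ne hτ
      simp only [TZ_T, ← (lT τ hτ).2.2.1]
      rw [div_eq_div_iff (pow_ne_zero _ (mul_ne_zero zn z)) (pow_ne_zero _ z)]
      linear_combination (-C (τ + 1) * TZ τ 0 ^ 6 * eC (1 / 8) ^ 4 + C (τ + 1) * TZ τ 0 ^ 6) * zz)
    (fun τ hτ => by
      have z := X_ne hτ
      have s := sqf_ne hτ
      simp only [TX_S0 hτ]
      rw [div_eq_div_iff (pow_ne_zero _ (mul_ne_zero s z)) (pow_ne_zero _ z)]
      refine mul_left_cancel₀ (pow_ne_zero 2 s) ?_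
      linear_combination TX τ 0 ^ 6 * (lS τ hτ).1 - TX τ 0 ^ 6 * A τ * sqf8 τ)
    (fun τ hτ => by
      have z := Z_ne hτ
      have s := sqf_ne hτ
      simp only [TY_S0 hτ]
      rw [div_eq_div_iff (pow_ne_zero _ (mul_ne_zero s z)) (pow_ne_zero _ z)]
      refine mul_left_cancel₀ (pow_ne_zero 2 s) ?_
      linear_combination TZ τ 0 ^ 6 * (lS τ hτ).2.2.1 - TZ τ 0 ^ 6 * C τ * sqf8 τ)
    (fun τ hτ => by
      have z := Y_ne hτ
      have s := sqf_ne hτ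
      simp only [TZ_S0 hτ]
      rw [div_eq_div_iff (pow_ne_zero _ (mul_ne_zero s z)) (pow_ne_zero _ z)]
      refine mul_left_cancel₀ (pow_ne_zero 2 s) ?_
      linear_combination TY τ 0 ^ 6 * (lS τ hτ).2.1 - TY τ 0 ^ 6 * B τ * sqf8 τ)
  obtain ⟨c₂, h₂⟩ := triple (f := fun τ => -F τ / (TY τ 0 ^ 3 * TZ τ 0 ^ 3)) (g := fun τ => E τ / (TX τ 0 ^ 3 * TZ τ 0 ^ 3))
    (k := fun τ => D τ / (TX τ 0 ^ 3 * TY τ 0 ^ 3))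
    (dF.neg.div ((dY.pow 3).mul (dZ.pow 3)) fun τ hτ => mul_ne_zero (pow_ne_zero _ (Y_ne hτ)) (pow_ne_zero _ (Z_ne hτ)))
    (dE.div ((dX.pow 3).mul (dZ.pow 3)) fun τ hτ => mul_ne_zero (pow_ne_zero _ (X_ne hτ)) (pow_ne_zero _ (Z_ne hτ)))
    (dD.div ((dX.pow 3).mul (dY.pow 3)) fun τ hτ => mul_ne_zero (pow_ne_zero _ (X_ne hτ)) (pow_ne_zero _ (Y_ne hτ)))
    ⟨K * (M ^ 3 * M ^ 3), B0, fun τ hτ hB => by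
      obtain ⟨m1, m2, m3⟩ := hM τ hB
      obtain ⟨k1, k2, k3, k4, k5, k6⟩ := hK τ (hB1.trans hB)
      simp only [div_eq_mul_inv, mul_inv, ← inv_pow, norm_mul, norm_pow, norm_neg]
      refine ⟨?_, ?_, by gcongr⟩
      · calc _ ≤ K * ‖eC (1 / 8 * τ)‖ ^ 3 * (M ^ 3 * ‖(TZ τ 0)⁻¹‖ ^ 3) := by gcongr
          _ = K * (M ^ 3 * (‖eC (1 / 8 * τ)‖ * ‖(TZ τ 0)⁻¹‖) ^ 3) := by ring
          _ ≤ _ := by gcongr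
      · calc _ ≤ K * ‖eC (1 / 8 * τ)‖ ^ 3 * (M ^ 3 * ‖(TZ τ 0)⁻¹‖ ^ 3) := by gcongr
          _ = K * (M ^ 3 * (‖eC (1 / 8 * τ)‖ * ‖(TZ τ 0)⁻¹‖) ^ 3) := by ring
          _ ≤ _ := by gcongr⟩
    (fun τ hτ => by
      have x := X_ne hτ
      have z := Z_ne hτ
      simp only [TY_T, TZ_T, ← (lT τ hτ).2.2.2.2.1]
      rw [div_eq_div_iff (mul_ne_zero (pow_ne_zero _ x) (pow_ne_zero _ (mul_ne_zero zn z))) (mul_ne_zero (pow_ne_zero _ x) (pow_ne_zero _ z))]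
      linear_combination (-F (τ + 1) * TX τ 0 ^ 3 * TZ τ 0 ^ 3) * zz)
    (fun τ hτ => by
      have x := Y_ne hτ
      have z := Z_ne hτ
      simp only [TX_T, TZ_T, ← (lT τ hτ).2.2.2.2.2]
      rw [div_eq_div_iff (mul_ne_zero (pow_ne_zero _ x) (pow_ne_zero _ (mul_ne_zero zn z))) (mul_ne_zero (pow_ne_zero _ x) (pow_ne_zero _ z))]
      linear_combination (E (τ + 1) * TY τ 0 ^ 3 * TZ τ 0 ^ 3) * zz)
    (fun τ hτ => by simp only [TX_T, TY_T, (lT τ hτ).2.2.2.1]; ring)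
    (fun τ hτ => by
      have y := Y_ne hτ
      have z := Z_ne hτ
      have s := sqf_ne hτ
      simp only [TY_S0 hτ, TZ_S0 hτ]
      rw [div_eq_div_iff (mul_ne_zero (pow_ne_zero _ (mul_ne_zero s z)) (pow_ne_zero _ (mul_ne_zero s y))) (mul_ne_zero (pow_ne_zero _ y) (pow_ne_zero _ z))]
      refine mul_left_cancel₀ (pow_ne_zero 2 s) ?_
      linear_combination -TY τ 0 ^ 3 * TZ τ 0 ^ 3 * (lS τ hτ).2.2.2.2.2 + TY τ 0 ^ 3 * TZ τ 0 ^ 3 * F τ * sqf8 τ)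
    (fun τ hτ => by
      have x := X_ne hτ
      have y := Y_ne hτ
      have s := sqf_ne hτ
      simp only [TX_S0 hτ, TZ_S0 hτ]
      rw [div_eq_div_iff (mul_ne_zero (pow_ne_zero _ (mul_ne_zero s x)) (pow_ne_zero _ (mul_ne_zero s y))) (mul_ne_zero (pow_ne_zero _ x) (pow_ne_zero _ y))]
      refine mul_left_cancel₀ (pow_ne_zero 2 s) ?_
      linear_combination TX τ 0 ^ 3 * TY τ 0 ^ 3 * (lS τ hτ).2.2.2.1 - TX τ 0 ^ 3 * TY τ 0 ^ 3 * D τ * sqf8 τ)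
    (fun τ hτ => by
      have x := X_ne hτ
      have z := Z_ne hτ
      have s := sqf_ne hτ
      simp only [TX_S0 hτ, TY_S0 hτ]
      rw [div_eq_div_iff (mul_ne_zero (pow_ne_zero _ (mul_ne_zero s x)) (pow_ne_zero _ (mul_ne_zero s z))) (mul_ne_zero (pow_ne_zero _ x) (pow_ne_zero _ z))]
      refine mul_left_cancel₀ (pow_ne_zero 2 s) ?_
      linear_combination TX τ 0 ^ 3 * TZ τ 0 ^ 3 * (lS τ hτ).2.2.2.2.1 - TX τ 0 ^ 3 * TZ τ 0 ^ 3 * E τ * sqf8 τ)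
  refine ⟨c₁, c₂, fun τ u v hτ => ?_⟩
  obtain ⟨a1, a2, a3⟩ := h₁ τ hτ
  obtain ⟨a4, a5, a6⟩ := h₂ τ hτ
  have x := X_ne hτ
  have y := Y_ne hτ
  have z := Z_ne hτ
  rw [div_eq_iff (by positivity)] at a1 a2 a3 a4 a5 a6
  rw [hexp τ u v hτ]
  unfold SC G1 G2
  linear_combination (TX τ u * TX τ v) * a1 + (TY τ u * TY τ v) * a2 + (TZ τ u * TZ τ v) * a3 +
    (TX τ u * TY τ v + TY τ u * TX τ v) * a6 + (TX τ u * TZ τ v + TZ τ u * TX τ v) * a5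
      - (TY τ u * TZ τ v + TZ τ u * TY τ v) * a4

lemma part4 {φ} (h : IsHJF 4 2 φ) : ∃ c₁ c₂ : ℂ, ∀ τ z₁ z₂ : ℂ, UHP τ →
    φ τ z₁ z₂ = c₁ * Phi42 τ z₁ z₂ + c₂ * PhiTilde42 τ z₁ z₂ := by
  obtain ⟨c₁, c₂, hc⟩ := main4 h
  refine ⟨c₁, c₂, fun τ z₁ z₂ hτ => ?_⟩
  rw [Phi42_eq hτ, PhiTilde42_eq hτ, ← hc τ _ _ hτ]
  unfold GU
  congr 1
  · linear_combination (z₁ - z₂) / 2 * I_sq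
  · linear_combination -(z₁ - z₂) / 2 * I_sq

lemma part3 (c₁ c₂ : ℂ) (h : ∀ τ z₁ z₂ : ℂ, UHP τ → c₁ * Phi42 τ z₁ z₂ + c₂ * PhiTilde42 τ z₁ z₂ = 0) :
    c₁ = 0 ∧ c₂ = 0 := by
  have := indep2z (A := c₁ * TX I 0 ^ 6) (B := c₁ * TY I 0 ^ 6) (C := c₁ * TZ I 0 ^ 6)
    (D := c₂ * (TX I 0 ^ 3 * TY I 0 ^ 3)) (E := c₂ * (TX I 0 ^ 3 * TZ I 0 ^ 3)) (F := -c₂ * (TY I 0 ^ 3 * TZ I 0 ^ 3)) UI (fun u v => by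
      have := h I (u - I * v) (u + I * v) UI
      rw [Phi42_eq UI, PhiTilde42_eq UI, show (u - I * v + (u + I * v)) / 2 = u by ring,
        show I * (u - I * v - (u + I * v)) / 2 = v by linear_combination (-v) * I_sq] at this
      unfold G1 G2 at this
      unfold SC
      linear_combination this)
  have x := X_ne UI
  have y := Y_ne UI
  have h1 := this.1
  have h2 := this.2.2.2.1
  simpa [x, y] using And.intro h1 h2


/-- `J_{4,2}(O_K)` is spanned by the linearly independent forms
`Φ_{4,2}` and `Φ̃_{4,2}`. -/
theorem stmt17 :
    IsHJF 4 2 Phi42 ∧ IsHJF 4 2 PhiTilde42 ∧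
    (∀ c₁ c₂ : ℂ,
      (∀ τ z₁ z₂ : ℂ, UHP τ → c₁ * Phi42 τ z₁ z₂ + c₂ * PhiTilde42 τ z₁ z₂ = 0) →
      c₁ = 0 ∧ c₂ = 0) ∧
    (∀ φ : ℂ → ℂ → ℂ → ℂ, IsHJF 4 2 φ →
      ∃ c₁ c₂ : ℂ, ∀ τ z₁ z₂ : ℂ, UHP τ →
        φ τ z₁ z₂ = c₁ * Phi42 τ z₁ z₂ + c₂ * PhiTilde42 τ z₁ z₂) := by
  exact ⟨hjf1, hjf2, part3, fun φ h => part4 h⟩
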